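/- arXiv:1612.09388 — 7 statements merged into one kernel-verified Lean document; each statement's English description precedes it below -/
import Mathlib

section
/- There exists m₀ such that for all m ≥ m₀ and all n ≥ 4, every non-adaptive (m,n,s,3)-scheme in which every query function equals (x,y,z) ↦ (x∧y∧z)∨(¬y∧¬z), or in which every query function equals its complement, satisfies s ≥ (1/7)·m^{1 − 1/(⌊n/4⌋+1)}. -/
/-- Semantic connectivity: the edges of `P` force equality of the values at `x` and `y`. -/
def Conn {E V : Type*} (b c : E → V) (P : Finset E) (x y : V) : Prop :=
  ∀ g : V → Bool, (∀ p ∈ P, g (b p) = g (c p)) → g x = g y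

set_option linter.unusedSectionVars false

section conn
variable {E V : Type*} [DecidableEq E] [DecidableEq V] {b c : E → V}

lemma Conn.mono {P Q : Finset E} {x y : V} (h : Conn b c P x y) (hPQ : P ⊆ Q) :
    Conn b c Q x y := fun g hg => h g fun p hp => hg p (hPQ hp)

lemma Conn.symm {P : Finset E} {x y : V} (h : Conn b c P x y) : Conn b c P y x :=
  fun g hg => (h g hg).symm

lemma Conn.trans {P : Finset E} {x y z : V} (h : Conn b c P x y) (h' : Conn b c P y z) :
    Conn b c P x z := fun g hg => (h g hg).trans (h' g hg)

/-- Separating function for a member of a minimal connecting set. -/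
lemma sep_fun {P : Finset E} {x y : V} (hP : Conn b c P x y) {p : E}
    (hmin : ¬ Conn b c (P.erase p) x y) :
    ∃ h : V → Bool, (∀ q ∈ P, q ≠ p → h (b q) = h (c q)) ∧ h x ≠ h y ∧ h (b p) ≠ h (c p) := by
  unfold Conn at hmin
  push Not at hmin
  obtain ⟨h, h1, h2⟩ := hmin
  refine ⟨h, fun q hq hqp => h1 q (Finset.mem_erase.2 ⟨hqp, hq⟩), h2, fun h3 => h2 (hP h ?_)⟩
  intro q hq
  by_cases hqp : q = p
  · rw [hqp]; exact h3
  · exact h1 q (Finset.mem_erase.2 ⟨hqp, hq⟩)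

lemma circ_B {P : Finset E} {x y : V} (hP : Conn b c P x y) {p : E}
    (hmin : ¬ Conn b c (P.erase p) x y) (g : V → Bool)
    (hg : ∀ q ∈ P, q ≠ p → g (b q) = g (c q)) (hxy : g x = g y) : g (b p) = g (c p) := by
  obtain ⟨h, h1, h2, h3⟩ := sep_fun hP hmin
  by_contra hne
  have := hP (fun v => xor (g v) (h v)) (by
    intro q hq
    by_cases hqp : q = p
    · subst hqp
      revert hne h3
      cases g (b q) <;> cases g (c q) <;> cases h (b q) <;> cases h (c q) <;> simp
    · simp only [hg q hq hqp, h1 q hq hqp])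
  simp only [hxy] at this
  apply h2
  revert this
  cases g y <;> cases h x <;> cases h y <;> simp

/-- On a minimal connecting set, a consistent function takes one value. -/
lemma circ_A {P : Finset E} {x y : V} (hP : Conn b c P x y) {p : E} (hp : p ∈ P)
    (hmin : ¬ Conn b c (P.erase p) x y) (g : V → Bool)
    (hg : ∀ q ∈ P, g (b q) = g (c q)) : g (b p) = g x := by
  obtain ⟨h, h1, h2, h3⟩ := sep_fun hP hmin
  by_contra hne
  have hxy := hP g hg
  have := hP (fun v => if g v = g x then h v else false) (by
    intro q hq
    by_cases hqp : q = p
    · subst hqp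
      have := hg q hq
      simp only [← this, hne, if_false]
    · simp only [hg q hq, h1 q hq hqp])
  simp only [← hxy, if_true] at this
  exact h2 this

lemma circ_conn {P : Finset E} {x y : V} (hP : Conn b c P x y) {p : E} (hp : p ∈ P)
    (hmin : ¬ Conn b c (P.erase p) x y) : Conn b c P x (b p) ∧ Conn b c P x (c p) :=
  ⟨fun g hg => (circ_A hP hp hmin g hg).symm,
   fun g hg => ((hg p hp).symm.trans (circ_A hP hp hmin g hg)).symm⟩

/-- `p` joins `u` and `w`. -/
def Joins (b c : E → V) (p : E) (u w : V) : Prop := (b p = u ∧ c p = w) ∨ (b p = w ∧ c p = u)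

lemma Joins.symm {p : E} {u w : V} (h : Joins b c p u w) : Joins b c p w u := Or.symm h

lemma Joins.eq {p : E} {u w : V} (h : Joins b c p u w) (g : V → Bool) :
    g (b p) = g (c p) ↔ g u = g w := by
  rcases h with ⟨h1, h2⟩ | ⟨h1, h2⟩
  · rw [h1, h2]
  · rw [h1, h2]; exact eq_comm

lemma Joins.conn {p : E} {u w : V} (h : Joins b c p u w) {P : Finset E} (hp : p ∈ P) :
    Conn b c P u w := fun g hg => (h.eq g).1 (hg p hp)

lemma Joins.conn_iff {p : E} {u w : V} (h : Joins b c p u w) {P : Finset E} :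
    Conn b c P u w ↔ Conn b c P (b p) (c p) :=
  ⟨fun hc g hg => (h.eq g).2 (hc g hg), fun hc g hg => (h.eq g).1 (hc g hg)⟩

lemma drop_last {P : Finset E} {v u w : V} (hP : Conn b c P v u) {p : E}
    (hmin : ¬ Conn b c (P.erase p) v u) (hj : Joins b c p u w) :
    Conn b c (P.erase p) v w := by
  intro g hg
  obtain ⟨h, h1, h2, h3⟩ := sep_fun hP hmin
  by_contra hne
  have h4 : h u ≠ h w := fun h => h3 ((hj.eq _).2 h)
  by_cases hc : g u = g w
  · apply hne
    rw [← hc]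
    apply hP g
    intro q hq
    by_cases hqp : q = p
    · rw [hqp]; exact (hj.eq _).2 hc
    · exact hg q (Finset.mem_erase.2 ⟨hqp, hq⟩)
  · have := hP (fun z => xor (g z) (h z)) (by
      intro q hq
      by_cases hqp : q = p
      · rw [hqp]
        refine (hj.eq (fun z => xor (g z) (h z))).2 ?_
        show xor (g u) (h u) = xor (g w) (h w)
        revert hc h4
        cases g u <;> cases g w <;> cases h u <;> cases h w <;> simp
      · simp only [hg q (Finset.mem_erase.2 ⟨hqp, hq⟩), h1 q hq hqp])
    revert this hc hne h2
    cases g u <;> cases g w <;> cases g v <;> cases h u <;> cases h v <;> simp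

/-- reachable from `v` using at most `i` edges of `R` -/
def Rch (b c : E → V) (R : Finset E) (v : V) (i : ℕ) (u : V) : Prop :=
  ∃ P ⊆ R, P.card ≤ i ∧ Conn b c P v u

lemma Rch.mono {R : Finset E} {v u : V} {i j : ℕ} (h : Rch b c R v i u) (hij : i ≤ j) :
    Rch b c R v j u := by
  obtain ⟨P, h1, h2, h3⟩ := h
  exact ⟨P, h1, h2.trans hij, h3⟩

lemma Rch.exists_min {R : Finset E} {v u : V} {i : ℕ} (h : Rch b c R v i u) :
    ∃ P ⊆ R, P.card ≤ i ∧ Conn b c P v u ∧ ∀ p ∈ P, ¬ Conn b c (P.erase p) v u := by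
  induction i with
  | zero =>
    obtain ⟨P, h1, h2, h3⟩ := h
    refine ⟨P, h1, h2, h3, ?_⟩
    have : P = ∅ := by simpa using h2
    simp [this]
  | succ i ih =>
    by_cases hi : Rch b c R v i u
    · obtain ⟨P, h1, h2, h3⟩ := ih hi
      exact ⟨P, h1, by omega, h3⟩
    · obtain ⟨P, h1, h2, h3⟩ := h
      refine ⟨P, h1, h2, h3, fun p hp hc => hi ⟨P.erase p, (Finset.erase_subset _ _).trans h1, ?_, hc⟩⟩
      rw [Finset.card_erase_of_mem hp]; omega

/-- no short cycle through edges of `R` -/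
def NoShort (b c : E → V) (R : Finset E) (k : ℕ) : Prop :=
  ∀ e ∈ R, ∀ P ⊆ R, e ∉ P → P.card ≤ k → ¬ Conn b c P (b e) (c e)

lemma NoShort.uniq {R : Finset E} {t : ℕ} (hR : NoShort b c R (2 * t)) {v u w w' : V} {i : ℕ}
    (hi : i < t) (hu : ¬ Rch b c R v i u) {e e' : E} (he : e ∈ R) (he' : e' ∈ R)
    (hj : Joins b c e u w) (hj' : Joins b c e' u w') (hw : Rch b c R v i w)
    (hw' : Rch b c R v i w') : e = e' := by
  by_contra hne
  obtain ⟨P, h1, h2, h3, h4⟩ := hw.exists_min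
  obtain ⟨P', h1', h2', h3', h4'⟩ := hw'.exists_min
  have key : ∀ {Q : Finset E} {z : V}, Q ⊆ R → Q.card ≤ i → Conn b c Q v z →
      (∀ p ∈ Q, ¬ Conn b c (Q.erase p) v z) → e ∉ Q := by
    intro Q z q1 q2 q3 q4 heQ
    have := circ_conn q3 heQ (q4 e heQ)
    apply hu
    rcases hj with ⟨hj, -⟩ | ⟨-, hj⟩
    · exact ⟨Q, q1, q2, hj ▸ this.1⟩
    · exact ⟨Q, q1, q2, hj ▸ this.2⟩
  refine hR e he (insert e' (P ∪ P')) ?_ ?_ ?_ (hj.conn_iff.1 ?_)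
  · intro x hx
    simp only [Finset.mem_insert, Finset.mem_union] at hx
    rcases hx with rfl | hx | hx
    · exact he'
    · exact h1 hx
    · exact h1' hx
  · simp only [Finset.mem_insert, Finset.mem_union, not_or]
    exact ⟨hne, key h1 h2 h3 h4, key h1' h2' h3' h4'⟩
  · have := Finset.card_insert_le e' (P ∪ P')
    have := Finset.card_union_le P P'
    omega
  · refine (hj'.conn (Finset.mem_insert_self _ _)).trans (Conn.trans (y := v) ?_ ?_)
    · exact (h3'.mono (by intro x hx; simp [hx])).symm
    · exact (h3.mono (by intro x hx; simp [hx]))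

/-- no edges inside a layer -/
lemma NoShort.layer {R : Finset E} {t : ℕ} (hR : NoShort b c R (2 * t)) {v u w : V} {i : ℕ}
    (hi : i ≤ t) (hu : Rch b c R v i u) (hw : Rch b c R v i w)
    (hu' : ∀ j < i, ¬ Rch b c R v j u) (hw' : ∀ j < i, ¬ Rch b c R v j w) {e : E} (he : e ∈ R)
    (hj : Joins b c e u w) : False := by
  obtain ⟨P, h1, h2, h3, h4⟩ := hu.exists_min
  obtain ⟨P', h1', h2', h3', h4'⟩ := hw.exists_min
  have hP : e ∉ P := by
    intro heP
    have hpos := Finset.card_pos.2 ⟨e, heP⟩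
    refine hw' (i - 1) (by omega) ⟨P.erase e, (Finset.erase_subset _ _).trans h1, ?_,
      drop_last h3 (h4 e heP) hj⟩
    rw [Finset.card_erase_of_mem heP]; omega
  have hP' : e ∉ P' := by
    intro heP
    have hpos := Finset.card_pos.2 ⟨e, heP⟩
    refine hu' (i - 1) (by omega) ⟨P'.erase e, (Finset.erase_subset _ _).trans h1', ?_,
      drop_last h3' (h4' e heP) hj.symm⟩
    rw [Finset.card_erase_of_mem heP]; omega
  refine hR e he (P ∪ P') (Finset.union_subset h1 h1') (by simp [hP, hP']) ?_ (hj.conn_iff.1 ?_)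
  · have := Finset.card_union_le P P'
    omega
  · exact (h3.mono Finset.subset_union_left).symm.trans (h3'.mono Finset.subset_union_right)

lemma NoShort.mono {R R' : Finset E} {k : ℕ} (hR : NoShort b c R k) (h : R' ⊆ R) :
    NoShort b c R' k := fun e he P hP heP hk => hR e (h he) P (hP.trans h) heP hk

/-- subgraph of large minimum degree -/
lemma exists_min_deg (K : ℕ) (W : Finset V) : ∀ R : Finset E,
    (∀ e ∈ R, b e ∈ W ∧ c e ∈ W) → K * W.card < R.card →
    ∃ R' ⊆ R, R'.Nonempty ∧ ∀ e ∈ R', ∀ u, (b e = u ∨ c e = u) →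
      K < (R'.filter fun e => b e = u ∨ c e = u).card := by
  induction W using Finset.strongInduction with
  | H W ih =>
    intro R hR hc
    by_cases hall : ∀ e ∈ R, ∀ u, (b e = u ∨ c e = u) →
      K < (R.filter fun e => b e = u ∨ c e = u).card
    · exact ⟨R, subset_rfl, Finset.card_pos.1 (by omega), hall⟩
    push Not at hall
    obtain ⟨e, he, u, hu, hd⟩ := hall
    have huW : u ∈ W := by
      rcases hu with h | h
      · exact h ▸ (hR e he).1
      · exact h ▸ (hR e he).2
    obtain ⟨R', h1, h2⟩ := ih (W.erase u) (Finset.erase_ssubset huW)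
      (R.filter fun e => ¬ (b e = u ∨ c e = u)) (by
        intro e he
        simp only [Finset.mem_filter, not_or] at he
        simp only [Finset.mem_erase]
        exact ⟨⟨he.2.1, (hR e he.1).1⟩, he.2.2, (hR e he.1).2⟩) (by
        have h3 := Finset.card_filter_add_card_filter_not (s := R) (fun e => b e = u ∨ c e = u)
        have h4 := Finset.card_erase_add_one huW
        rw [← h4] at hc
        rw [mul_add] at hc
        omega)
    exact ⟨R', h1.trans (Finset.filter_subset _ _), h2⟩

lemma moore [Fintype V] {R : Finset E} {K t : ℕ} (ht : 1 ≤ t) (hR : NoShort b c R (2 * t))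
    (hcard : K * Fintype.card V < R.card) : K ^ t ≤ Fintype.card V := by
  classical
  obtain ⟨R', hsub, ⟨e0, he0⟩, hdeg⟩ := exists_min_deg (b := b) (c := c) K Finset.univ R
    (by simp) (by simpa using hcard)
  replace hR := hR.mono hsub
  clear hcard hsub
  set v := b e0 with hv
  let L : ℕ → Finset V := fun i =>
    Finset.univ.filter fun u => Rch b c R' v i u ∧ ∀ j < i, ¬ Rch b c R' v j u
  have hL : ∀ i u, u ∈ L i ↔ Rch b c R' v i u ∧ ∀ j < i, ¬ Rch b c R' v j u := by
    intro i u; simp [L]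
  have h0 : v ∈ L 0 := by
    rw [hL]; exact ⟨⟨∅, by simp, by simp, fun g _ => rfl⟩, by simp⟩
  -- every vertex of a layer is incident to an edge
  have hinc : ∀ i, ∀ u ∈ L i, ∃ e ∈ R', b e = u ∨ c e = u := by
    intro i u hu
    by_contra hno
    push Not at hno
    obtain ⟨P, p1, p2, p3⟩ := ((hL i u).1 hu).1
    have := p3 (fun z => decide (z = u)) (by
      intro p hp
      have := hno p (p1 hp)
      simp [this.1, this.2])
    have huv : v ≠ u := (hno e0 he0).1
    simp [huv] at this
  have hstep : ∀ i < t, (L i).card * K ≤ (L (i + 1)).card := by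
    intro i hi
    have := Finset.card_mul_le_card_mul (s := L i) (t := L (i + 1)) (m := K) (n := 1)
      (fun u w => ∃ e ∈ R', Joins b c e u w) ?_ ?_
    · simpa using this
    · intro u hu
      obtain ⟨e1, he1, hu1⟩ := hinc i u hu
      have hd := hdeg e1 he1 u hu1
      obtain ⟨hu2, hu3⟩ := (hL i u).1 hu
      set I := R'.filter fun e => b e = u ∨ c e = u with hI
      let o : E → V := fun e => if b e = u then c e else b e
      have ho : ∀ e ∈ I, e ∈ R' ∧ Joins b c e u (o e) := by
        intro e he
        obtain ⟨h1, h2⟩ := Finset.mem_filter.1 he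
        refine ⟨h1, ?_⟩
        by_cases h : b e = u
        · left; exact ⟨h, by simp [o, h]⟩
        · right; exact ⟨by simp [o, h], by tauto⟩
      have hbad : (I.filter fun e => Rch b c R' v i (o e)).card ≤ 1 := by
        rw [Finset.card_le_one]
        intro e he e' he'
        obtain ⟨h1, h2⟩ := Finset.mem_filter.1 he
        obtain ⟨h1', h2'⟩ := Finset.mem_filter.1 he'
        have hlow : ∀ e ∈ I, Rch b c R' v i (o e) → ∃ j < i, Rch b c R' v j (o e) := by
          intro e he hr
          by_contra hno
          push Not at hno
          exact hR.layer hi.le hu2 hr hu3 hno (ho e he).1 (ho e he).2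
        obtain ⟨j, hj, hr⟩ := hlow e h1 h2
        obtain ⟨j', hj', hr'⟩ := hlow e' h1' h2'
        exact hR.uniq (i := i - 1) (by omega) (hu3 _ (by omega)) (ho e h1).1 (ho e' h1').1
          (ho e h1).2 (ho e' h1').2 (hr.mono (by omega)) (hr'.mono (by omega))
      have hsum := Finset.card_filter_add_card_filter_not (s := I)
        (fun e => Rch b c R' v i (o e))
      have himg : (I.filter fun e => ¬ Rch b c R' v i (o e)).card ≤
          (Finset.bipartiteAbove (fun u w => ∃ e ∈ R', Joins b c e u w) (L (i + 1)) u).card := by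
        apply Finset.card_le_card_of_injOn o
        · intro e he
          obtain ⟨h1, h2⟩ := Finset.mem_filter.1 he
          simp only [Finset.coe_filter, Finset.bipartiteAbove, Set.mem_ofPred_eq]
          refine ⟨?_, e, (ho e h1).1, (ho e h1).2⟩
          rw [hL]
          constructor
          · obtain ⟨P, p1, p2, p3⟩ := hu2
            refine ⟨insert e P, Finset.insert_subset (ho e h1).1 p1, ?_, ?_⟩
            · have := Finset.card_insert_le e P
              omega
            · exact (p3.mono (Finset.subset_insert _ _)).trans
                ((ho e h1).2.conn (Finset.mem_insert_self _ _))
          · intro j hj hr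
            exact h2 (hr.mono (by omega))
        · intro e he e' he' hoo
          obtain ⟨h1, h2⟩ := Finset.mem_filter.1 he
          obtain ⟨h1', h2'⟩ := Finset.mem_filter.1 he'
          by_contra hne
          refine hR e (ho e h1).1 {e'} (by simpa using (ho e' h1').1) (by simpa using hne)
            (by simp; omega) ((ho e h1).2.conn_iff.1 ?_)
          rw [hoo]
          exact (ho e' h1').2.conn (by simp)
      omega
    · intro w hw
      obtain ⟨hw1, hw2⟩ := (hL _ _).1 hw
      rw [Finset.card_le_one]
      intro u hu u' hu'
      simp only [Finset.bipartiteBelow, Finset.mem_filter] at hu hu'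
      obtain ⟨hu, e, he, hj⟩ := hu
      obtain ⟨hu', e', he', hj'⟩ := hu'
      have hnw := hw2 i (by omega)
      have r := ((hL _ _).1 hu).1
      have r' := ((hL _ _).1 hu').1
      have := hR.uniq hi hnw he he' hj.symm hj'.symm r r'
      subst this
      have n1 : u ≠ w := fun h => hnw (h ▸ r)
      have n2 : u' ≠ w := fun h => hnw (h ▸ r')
      rcases hj with ⟨h1, h2⟩ | ⟨h1, h2⟩ <;> rcases hj' with ⟨h3, h4⟩ | ⟨h3, h4⟩
      · exact h1.symm.trans h3
      · exact absurd (h1.symm.trans h3) n1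
      · exact absurd (h2.symm.trans h4) n1
      · exact h2.symm.trans h4
  have hpow : ∀ i ≤ t, K ^ i ≤ (L i).card := by
    intro i
    induction i with
    | zero => intro _; simpa using Finset.card_pos.2 ⟨v, h0⟩
    | succ i ih =>
      intro hi
      calc K ^ (i + 1) = K ^ i * K := pow_succ _ _
        _ ≤ (L i).card * K := Nat.mul_le_mul_right _ (ih (by omega))
        _ ≤ _ := hstep i (by omega)
  exact (hpow t le_rfl).trans (Finset.card_le_univ _)

/-- realizability of partial membership patterns -/
def Real3 (a b c : E → V) (t : ℕ) : Prop :=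
  ∀ T U : Finset E, Disjoint T U → T.card ≤ 4 * t → U.card ≤ 2 → ∃ g : V → Bool,
    (∀ e ∈ T, g (b e) = g (c e) ∧ (g (b e) = true → g (a e) = true)) ∧
    (∀ e ∈ U, g (b e) = g (c e) → g (b e) = true ∧ g (a e) = false)

/-- minimal short certificates -/
def Cert (b c : E → V) (t : ℕ) (e : E) (P : Finset E) : Prop :=
  e ∉ P ∧ P.card ≤ 2 * t ∧ Conn b c P (b e) (c e) ∧ ∀ p ∈ P, ¬ Conn b c (P.erase p) (b e) (c e)

lemma cert_not_mem {a : E → V} {t : ℕ} (H : Real3 a b c t) {e e' : E} {P : Finset E}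
    (hP : Cert b c t e P) (ha : a e = a e') : e' ∉ P := by
  intro he'
  obtain ⟨h1, h2, h3, h4⟩ := hP
  obtain ⟨g, hT, hU⟩ := H P {e} (by simpa using h1) (by omega) (by simp)
  have hc : ∀ q ∈ P, g (b q) = g (c q) := fun q hq => (hT q hq).1
  have hge := hU e (by simp) (h3 g hc)
  have hA := circ_A h3 he' (h4 e' he') g hc
  have := (hT e' he').2 (hA.trans hge.1)
  rw [← ha, hge.2] at this
  exact absurd this (by simp)

lemma short_inj {a : E → V} {t : ℕ} (ht : 1 ≤ t) (H : Real3 a b c t) {e e' : E}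
    {P P' : Finset E} (hP : Cert b c t e P) (hP' : Cert b c t e' P') (hl : b e' ≠ c e')
    (ha : a e = a e') : e = e' := by
  by_contra hne
  have k1 := cert_not_mem H hP ha
  have k2 := cert_not_mem H hP' ha.symm
  obtain ⟨h1, h2, h3, h4⟩ := hP
  obtain ⟨h1', h2', h3', h4'⟩ := hP'
  by_cases hs : P' ⊆ P
  · obtain ⟨g, hT, hU⟩ := H (insert e' P) {e} (by simp [h1, hne])
      (by have := Finset.card_insert_le e' P; omega) (by simp)
    have hc : ∀ q ∈ P, g (b q) = g (c q) := fun q hq => (hT q (by simp [hq])).1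
    have hge := hU e (by simp) (h3 g hc)
    have hne' : P'.Nonempty := by
      rw [Finset.nonempty_iff_ne_empty]
      rintro rfl
      have := h3' (fun z => decide (z = b e')) (by simp)
      simp at this
      exact hl this.symm
    obtain ⟨p, hp⟩ := hne'
    have hA := circ_A h3 (hs hp) (h4 p (hs hp)) g hc
    have hA' := circ_A h3' hp (h4' p hp) g (fun q hq => hc q (hs hq))
    have := (hT e' (by simp)).2 (hA'.symm.trans (hA.trans hge.1))
    rw [← ha, hge.2] at this
    exact absurd this (by simp)
  · obtain ⟨p, hp, hpP⟩ := Finset.not_subset.1 hs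
    have hpe : p ≠ e' := fun h => h1' (h ▸ hp)
    obtain ⟨g, hT, hU⟩ := H (insert e' (P ∪ P'.erase p)) {e, p} (by
        rw [Finset.disjoint_right]
        intro x hx
        simp only [Finset.mem_insert, Finset.mem_singleton] at hx
        rcases hx with rfl | rfl
        · simp [hne, h1, k2]
        · simp [hpe, hpP])
      (by
        have := Finset.card_insert_le e' (P ∪ P'.erase p)
        have := Finset.card_union_le P (P'.erase p)
        have := Finset.card_erase_add_one hp
        omega) (Finset.card_le_two)
    have hc : ∀ q ∈ P, g (b q) = g (c q) := fun q hq => (hT q (by simp [hq])).1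
    have hge := hU e (by simp) (h3 g hc)
    have hc' : ∀ q ∈ P', q ≠ p → g (b q) = g (c q) :=
      fun q hq hqp => (hT q (by simp [hq, hqp])).1
    have he' := hT e' (by simp)
    have hgp := circ_B h3' (h4' p hp) g hc' he'.1
    have hgp' := hU p (by simp) hgp
    have hA' := circ_A h3' hp (h4' p hp) g (by
      intro q hq
      by_cases hqp : q = p
      · rw [hqp]; exact hgp
      · exact hc' q hq hqp)
    have := he'.2 (hA'.symm.trans hgp'.1)
    rw [← ha, hge.2] at this
    exact absurd this (by simp)

lemma loops {a : E → V} {t : ℕ} (ht : 1 ≤ t) (H : Real3 a b c t) {e e1 e3 : E}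
    (h1 : b e1 = c e1) (h3 : b e3 = c e3) (n1 : e1 ≠ e) (n3 : e3 ≠ e)
    (ha : a e1 = a e) (hb : b e3 = b e) : False := by
  obtain ⟨g, hT, hU⟩ := H {e} {e1, e3} (by simp [n1.symm, n3.symm]) (by simp; omega)
    Finset.card_le_two
  have k1 := hU e1 (by simp) (by rw [h1])
  have k3 := hU e3 (by simp) (by rw [h3])
  have k := (hT e (by simp)).2 (hb ▸ k3.1)
  rw [← ha, k1.2] at k
  exact absurd k (by simp)

lemma count [Fintype V] [Fintype E] {a : E → V} {t K : ℕ} (ht : 1 ≤ t) (H : Real3 a b c t)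
    (hK : Fintype.card V < K ^ t) :
    Fintype.card E ≤ 3 * Fintype.card V + K * Fintype.card V := by
  classical
  let Lp := Finset.univ.filter fun e : E => b e = c e
  let N := Finset.univ.filter fun e : E => ¬ b e = c e
  let Sh := N.filter fun e => ∃ P, Cert b c t e P
  let R := N.filter fun e => ¬ ∃ P, Cert b c t e P
  let L1 := Lp.filter fun e => ∀ e1 ∈ Lp, a e1 = a e → e1 = e
  let L2 := Lp.filter fun e => ¬ ∀ e1 ∈ Lp, a e1 = a e → e1 = e
  have c1 : Lp.card + N.card = Fintype.card E :=
    Finset.card_filter_add_card_filter_not (s := Finset.univ) (fun e : E => b e = c e)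
  have c2 : Sh.card + R.card = N.card := Finset.card_filter_add_card_filter_not (s := N) _
  have c3 : L1.card + L2.card = Lp.card := Finset.card_filter_add_card_filter_not (s := Lp) _
  have b1 : L1.card ≤ Fintype.card V := by
    rw [← Finset.card_univ]
    refine Finset.card_le_card_of_injOn a (by simp) ?_
    intro e he e' he' h
    exact (Finset.mem_filter.1 he').2 e (Finset.mem_filter.1 he).1 h
  have b2 : L2.card ≤ Fintype.card V := by
    rw [← Finset.card_univ]
    refine Finset.card_le_card_of_injOn b (by simp) ?_
    intro e he e' he' h
    obtain ⟨h1, h2⟩ := Finset.mem_filter.1 he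
    have h1' := (Finset.mem_filter.1 he').1
    push Not at h2
    obtain ⟨e1, m1, m2, m3⟩ := h2
    by_contra hne
    exact loops ht H (Finset.mem_filter.1 m1).2 (Finset.mem_filter.1 h1').2 m3 (Ne.symm hne)
      m2 h.symm
  have b3 : Sh.card ≤ Fintype.card V := by
    rw [← Finset.card_univ]
    refine Finset.card_le_card_of_injOn a (by simp) ?_
    intro e he e' he' h
    obtain ⟨h1, P, h2⟩ := Finset.mem_filter.1 he
    obtain ⟨h1', P', h2'⟩ := Finset.mem_filter.1 he'
    exact short_inj ht H h2 h2' (Finset.mem_filter.1 h1').2 h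
  have b4 : R.card ≤ K * Fintype.card V := by
    by_contra hlt
    have hR : NoShort b c R (2 * t) := by
      intro e he P hP heP hk hc
      have hr : Rch b c P (b e) (2 * t) (c e) := ⟨P, subset_rfl, hk, hc⟩
      obtain ⟨Q, q1, q2, q3, q4⟩ := hr.exists_min
      exact (Finset.mem_filter.1 he).2 ⟨Q, fun h => heP (q1 h), q2, q3, q4⟩
    have := moore ht hR (not_le.1 hlt)
    omega
  omega

end conn

lemma final_bound {m s t : ℕ} (ht : 1 ≤ t)
    (h : ∀ K : ℕ, s < K ^ t → m ≤ 3 * s + K * s) :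
    (1 / 7 : ℝ) * (m : ℝ) ^ ((1 : ℝ) - 1 / ((t + 1 : ℕ) : ℝ)) ≤ (s : ℝ) := by
  have htR : (0 : ℝ) < t := by exact_mod_cast ht
  have hexp : (1 : ℝ) - 1 / ((t + 1 : ℕ) : ℝ) = t / (t + 1) := by
    push_cast; field_simp; ring
  rw [hexp]
  have hep : (0 : ℝ) < t / (t + 1) := by positivity
  rcases Nat.eq_zero_or_pos s with rfl | hs
  · have : m = 0 := by simpa using h 1 (by simp)
    subst this
    simp [Real.zero_rpow hep.ne']
  set x : ℝ := (s : ℝ) ^ ((1 : ℝ) / t) with hx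
  have hs1 : (1 : ℝ) ≤ s := by exact_mod_cast hs
  have hx1 : 1 ≤ x := Real.one_le_rpow hs1 (by positivity)
  have hxt : x ^ t = s := by
    rw [hx, one_div, Real.rpow_inv_natCast_pow (by positivity) (by omega)]
  have hm := h (⌊x⌋₊ + 1) (by
    have : (s : ℝ) < ((⌊x⌋₊ + 1 : ℕ) : ℝ) ^ t := by
      rw [← hxt]
      apply pow_lt_pow_left₀ _ (by positivity) (by omega)
      push_cast
      exact Nat.lt_floor_add_one x
    exact_mod_cast this)
  have hm' : (m : ℝ) ≤ 5 * (s * x) := by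
    have h1 : (m : ℝ) ≤ 3 * s + (⌊x⌋₊ + 1) * s := by exact_mod_cast hm
    have h2 : (⌊x⌋₊ : ℝ) ≤ x := Nat.floor_le (by positivity)
    nlinarith
  have hsx : (s : ℝ) * x = (s : ℝ) ^ (((t : ℝ) + 1) / t) := by
    rw [add_div, div_self htR.ne', Real.rpow_add (by positivity), Real.rpow_one]
  have h5 : (m : ℝ) ^ ((t : ℝ) / (t + 1)) ≤ 5 * s := by
    calc (m : ℝ) ^ ((t : ℝ) / (t + 1)) ≤ (5 * (s * x)) ^ ((t : ℝ) / (t + 1)) :=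
          Real.rpow_le_rpow (by positivity) hm' hep.le
      _ = 5 ^ ((t : ℝ) / (t + 1)) * s := by
          rw [Real.mul_rpow (by positivity) (by positivity), hsx, ← Real.rpow_mul (by positivity)]
          congr 1
          have : ((t : ℝ) + 1) / t * (t / (t + 1)) = 1 := by field_simp
          rw [this, Real.rpow_one]
      _ ≤ 5 * s := by
          gcongr
          calc (5 : ℝ) ^ ((t : ℝ) / (t + 1)) ≤ 5 ^ (1 : ℝ) :=
                Real.rpow_le_rpow_of_exponent_le (by norm_num) (by
                  rw [div_le_one (by positivity)]; linarith)
            _ = 5 := Real.rpow_one _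
  linarith


/-- There exists `m₀` such that for all `m ≥ m₀` and all `n ≥ 4`, every
non-adaptive `(m,n,s,3)`-scheme whose query function is
`(x,y,z) ↦ (x∧y∧z)∨(¬y∧¬z)` for every element, or is its complement for every
element, satisfies `s ≥ (1/7)·m^(1 - 1/(⌊n/4⌋+1))`. -/
theorem xyz_or_notynotz_three_probe_lower_bound :
    ∃ m₀ : ℕ, ∀ m : ℕ, m₀ ≤ m → ∀ n : ℕ, 4 ≤ n →
    ∀ s : ℕ, ∀ i₁ i₂ i₃ : Fin m → Fin s, ∀ φ : Finset (Fin m) → Fin s → Bool,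
      ((∀ S : Finset (Fin m), S.card ≤ n → ∀ x : Fin m,
          (((φ S (i₁ x) && φ S (i₂ x) && φ S (i₃ x)) ||
              (!(φ S (i₂ x)) && !(φ S (i₃ x)))) = true ↔ x ∈ S)) ∨
       (∀ S : Finset (Fin m), S.card ≤ n → ∀ x : Fin m,
          ((!((φ S (i₁ x) && φ S (i₂ x) && φ S (i₃ x)) ||
              (!(φ S (i₂ x)) && !(φ S (i₃ x))))) = true ↔ x ∈ S))) →
      (1 / 7 : ℝ) * (m : ℝ) ^ ((1 : ℝ) - 1 / ((n / 4 + 1 : ℕ) : ℝ)) ≤ (s : ℝ) := by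
  refine ⟨0, fun m _ n hn s i₁ i₂ i₃ φ h => ?_⟩
  have ht : 1 ≤ n / 4 := by omega
  have H : Real3 i₁ i₂ i₃ (n / 4) := by
    intro T U hTU hT hU
    rcases h with h | h
    · refine ⟨φ T, fun e he => ?_, fun e he => ?_⟩
      · have := (h T (by omega) e).2 he
        revert this
        cases φ T (i₁ e) <;> cases φ T (i₂ e) <;> cases φ T (i₃ e) <;> simp
      · have := mt (h T (by omega) e).1 (Finset.disjoint_right.1 hTU he)
        revert this
        cases φ T (i₁ e) <;> cases φ T (i₂ e) <;> cases φ T (i₃ e) <;> simp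
    · refine ⟨φ U, fun e he => ?_, fun e he => ?_⟩
      · have := mt (h U (by omega) e).1 (Finset.disjoint_left.1 hTU he)
        revert this
        cases φ U (i₁ e) <;> cases φ U (i₂ e) <;> cases φ U (i₃ e) <;> simp
      · have := (h U (by omega) e).2 he
        revert this
        cases φ U (i₁ e) <;> cases φ U (i₂ e) <;> cases φ U (i₃ e) <;> simp
  refine final_bound ht fun K hK => ?_
  simpa using count ht H (K := K) (by simpa using hK)
end

section
/- For all m and all n ≥ 1, every non-adaptive (m,n,s,3)-scheme in which every query function equals PARITY (the function (x,y,z) ↦ x⊕y⊕z) satisfies s ≥ m. -/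
/-- For all `m` and all `n ≥ 1`, every non-adaptive `(m,n,s,3)`-scheme
whose query function is PARITY `(x,y,z) ↦ x⊕y⊕z` for every element satisfies
`s ≥ m`. -/
theorem parity_three_probe_lower_bound :
    ∀ m n s : ℕ, 1 ≤ n →
    ∀ i₁ i₂ i₃ : Fin m → Fin s, ∀ φ : Finset (Fin m) → Fin s → Bool,
      (∀ S : Finset (Fin m), S.card ≤ n → ∀ x : Fin m,
        ((xor (xor (φ S (i₁ x)) (φ S (i₂ x))) (φ S (i₃ x))) = true ↔ x ∈ S)) →
      m ≤ s := by
  intro m n s hn i₁ i₂ i₃ φ h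
  let L : (Fin s → ZMod 2) →ₗ[ZMod 2] (Fin m → ZMod 2) :=
    LinearMap.funLeft (ZMod 2) (ZMod 2) i₁ + LinearMap.funLeft (ZMod 2) (ZMod 2) i₂
      + LinearMap.funLeft (ZMod 2) (ZMod 2) i₃
  have key : ∀ a b c : Bool, (if a then (1 : ZMod 2) else 0) + (if b then 1 else 0)
      + (if c then 1 else 0) = if (xor (xor a b) c) = true then 1 else 0 := by decide
  have hL : ∀ y : Fin m, L (fun j => if φ {y} j then 1 else 0) = Pi.single y 1 := by
    intro y
    funext x
    have h1 := h {y} (by simpa using hn) x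
    have h2 := key (φ {y} (i₁ x)) (φ {y} (i₂ x)) (φ {y} (i₃ x))
    rw [if_congr h1 rfl rfl] at h2
    simp only [Finset.mem_singleton] at h2
    rw [Pi.single_apply, ← h2]
    rfl
  have hr : LinearMap.range L = ⊤ := by
    rw [eq_top_iff]
    intro f _
    rw [pi_eq_sum_univ' f]
    refine Submodule.sum_mem _ fun y _ => Submodule.smul_mem _ _ ?_
    refine ⟨_, (hL y).trans ?_⟩
    funext x
    simp [Pi.single_apply, eq_comm]
  have := LinearMap.finrank_range_le L
  rw [hr, finrank_top] at this
  simpa using this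
end

section
/- For all m and all n ≥ 1, every non-adaptive (m,n,s,3)-scheme in which every query function equals the function (x,y,z) ↦ 1 iff x+y+z ≠ 1 (where x,y,z ∈ {0,1} and the sum is over the integers) satisfies s ≥ m. -/
/-- For all `m` and all `n ≥ 1`, every non-adaptive `(m,n,s,3)`-scheme
whose query function is `(x,y,z) ↦ 1 iff x+y+z ≠ 1` (sum over the integers) for
every element satisfies `s ≥ m`. -/
theorem sum_ne_one_three_probe_lower_bound :
    ∀ m n s : ℕ, 1 ≤ n →
    ∀ i₁ i₂ i₃ : Fin m → Fin s, ∀ φ : Finset (Fin m) → Fin s → Bool,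
      (∀ S : Finset (Fin m), S.card ≤ n → ∀ x : Fin m,
        (((φ S (i₁ x)).toNat + (φ S (i₂ x)).toNat + (φ S (i₃ x)).toNat ≠ 1) ↔ x ∈ S)) →
      m ≤ s := by
  intro m n s hn i₁ i₂ i₃ φ h
  -- The differences `φ {y} - φ ∅` are linearly independent over `ℚ`.
  let b : Finset (Fin m) → Fin s → ℚ := fun S j => ((φ S j).toNat : ℚ)
  have hb : ∀ S : Finset (Fin m), S.card ≤ n → ∀ x : Fin m,
      (b S (i₁ x) + b S (i₂ x) + b S (i₃ x) ≠ 1 ↔ x ∈ S) := by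
    intro S hS x
    rw [← h S hS x]
    simp only [b]
    norm_cast
  have h0 : ∀ x, b ∅ (i₁ x) + b ∅ (i₂ x) + b ∅ (i₃ x) = 1 := by
    intro x
    have := hb ∅ (by simp) x
    simpa using this
  have hli : LinearIndependent ℚ (fun y : Fin m => fun j : Fin s => b {y} j - b ∅ j) := by
    rw [Fintype.linearIndependent_iff]
    intro c hc x
    have e : ∀ j, ∑ y, c y * (b {y} j - b ∅ j) = 0 := by
      intro j
      have := congrFun hc j
      simpa [Finset.sum_apply] using this
    have e3 : ∑ y, c y * (b {y} (i₁ x) + b {y} (i₂ x) + b {y} (i₃ x) - 1) = 0 := by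
      have e' : ∑ y, (c y * (b {y} (i₁ x) - b ∅ (i₁ x)) + c y * (b {y} (i₂ x) - b ∅ (i₂ x))
          + c y * (b {y} (i₃ x) - b ∅ (i₃ x))) = 0 := by
        rw [Finset.sum_add_distrib, Finset.sum_add_distrib, e, e, e]; norm_num
      rw [← e']
      refine Finset.sum_congr rfl fun y _ => ?_
      rw [← h0 x]; ring
    rw [Finset.sum_eq_single x] at e3
    · have hx := (hb {x} (by simpa using hn) x).2 (by simp)
      exact (mul_eq_zero.1 e3).resolve_right (sub_ne_zero.2 hx)
    · intro y _ hy
      have hx := hb {y} (by simpa using hn) x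
      have : b {y} (i₁ x) + b {y} (i₂ x) + b {y} (i₃ x) = 1 := by
        by_contra hne
        exact hy (Finset.mem_singleton.1 (hx.1 hne)).symm
      rw [this]; ring
    · simp
  simpa using hli.fintype_card_le_finrank
end

section
/- For all m and all n with 1 ≤ n ≤ m/900, every non-adaptive (m,n,s,3)-scheme in which every query function equals (x,y,z) ↦ (x∧y)⊕z satisfies s ≥ (3/(5e))·√(mn). In particular s_N(m,n,3) = Ω(√(mn)) for this query function. -/
/-- Monomial in `s` Boolean variables, as a function to `ZMod 2`. -/
def mono2 {s : ℕ} (A : Finset (Fin s)) : (Fin s → Bool) → ZMod 2 :=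
  fun a => if ∀ j ∈ A, a j = true then 1 else 0

/-- Monomials of degree at most `d`. -/
def lowSets (s d : ℕ) : Finset (Finset (Fin s)) := Finset.univ.filter (fun A => A.card ≤ d)

/-- Span of low degree monomials. -/
def lowSpan (s d : ℕ) : Submodule (ZMod 2) ((Fin s → Bool) → ZMod 2) :=
  Submodule.span (ZMod 2) (Set.image mono2 (lowSets s d : Set (Finset (Fin s))))

lemma mono2_mul {s : ℕ} (A B : Finset (Fin s)) : mono2 A * mono2 B = mono2 (A ∪ B) := by
  funext a
  simp only [Pi.mul_apply, mono2, Finset.mem_union]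
  by_cases h1 : ∀ j ∈ A, a j = true
  · by_cases h2 : ∀ j ∈ B, a j = true
    · rw [if_pos h1, if_pos h2, if_pos]
      · simp
      · rintro j (h | h)
        exacts [h1 j h, h2 j h]
    · rw [if_neg h2, mul_zero, if_neg]
      intro h
      exact h2 fun j hj => h j (Or.inr hj)
  · rw [if_neg h1, zero_mul, if_neg]
    intro h
    exact h1 fun j hj => h j (Or.inl hj)

lemma mono2_mem {s d : ℕ} (A : Finset (Fin s)) (h : A.card ≤ d) : mono2 A ∈ lowSpan s d :=
  Submodule.subset_span ⟨A, by simpa [lowSets] using h, rfl⟩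

lemma lowSpan_mul {s d : ℕ} (f : (Fin s → Bool) → ZMod 2) (hf : f ∈ lowSpan s d)
    (B : Finset (Fin s)) (hB : B.card ≤ 2) : f * mono2 B ∈ lowSpan s (d + 2) := by
  unfold lowSpan at hf
  induction hf using Submodule.span_induction with
  | mem x hx =>
    obtain ⟨A, hA, rfl⟩ := hx
    rw [mono2_mul]
    apply mono2_mem
    have : A.card ≤ d := by simpa [lowSets] using hA
    have := Finset.card_union_le A B
    omega
  | zero => simp
  | add x y _ _ hx hy => rw [add_mul]; exact Submodule.add_mem _ hx hy
  | smul c x _ hx => rw [smul_mul_assoc]; exact Submodule.smul_mem _ _ hx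

/-- The query polynomial. -/
def qpoly {m s : ℕ} (i₁ i₂ i₃ : Fin m → Fin s) (x : Fin m) : (Fin s → Bool) → ZMod 2 :=
  mono2 {i₁ x, i₂ x} + mono2 {i₃ x}

lemma qprod_mem {m s : ℕ} (i₁ i₂ i₃ : Fin m → Fin s) (S : Finset (Fin m)) :
    ∏ x ∈ S, qpoly i₁ i₂ i₃ x ∈ lowSpan s (2 * S.card) := by
  induction S using Finset.induction_on with
  | empty =>
    have h : (1 : (Fin s → Bool) → ZMod 2) = mono2 ∅ := by funext a; simp [mono2]
    rw [Finset.prod_empty, h]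
    exact mono2_mem _ (by simp)
  | insert x S hx ih =>
    rw [Finset.prod_insert hx, Finset.card_insert_of_notMem hx, mul_comm (qpoly i₁ i₂ i₃ x), Nat.mul_add, qpoly, mul_add (∏ x ∈ S, qpoly i₁ i₂ i₃ x)]
    exact Submodule.add_mem _ (lowSpan_mul _ ih _ Finset.card_le_two)
      (lowSpan_mul _ ih _ (by simp))

lemma qpoly_eval {m s : ℕ} (i₁ i₂ i₃ : Fin m → Fin s) (x : Fin m) (a : Fin s → Bool) :
    qpoly i₁ i₂ i₃ x a = if (xor (a (i₁ x) && a (i₂ x)) (a (i₃ x))) = true then 1 else 0 := by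
  simp only [qpoly, Pi.add_apply, mono2, Finset.mem_insert, Finset.mem_singleton,
    forall_eq_or_imp, forall_eq]
  cases a (i₁ x) <;> cases a (i₂ x) <;> cases a (i₃ x) <;> decide

lemma choose_le_lowSets (m n s : ℕ) (i₁ i₂ i₃ : Fin m → Fin s)
    (φ : Finset (Fin m) → Fin s → Bool)
    (H : ∀ S : Finset (Fin m), S.card ≤ n → ∀ x : Fin m,
        ((xor (φ S (i₁ x) && φ S (i₂ x)) (φ S (i₃ x))) = true ↔ x ∈ S)) :
    m.choose n ≤ (lowSets s (2 * n)).card := by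
  classical
  let ι := {S : Finset (Fin m) // S ∈ Finset.powersetCard n (Finset.univ : Finset (Fin m))}
  let v : ι → ((Fin s → Bool) → ZMod 2) := fun S => ∏ x ∈ S.1, qpoly i₁ i₂ i₃ x
  have hc : ∀ S : ι, S.1.card = n := fun S => (Finset.mem_powersetCard.1 S.2).2
  have hv : ∀ S T : ι, v S (φ T.1) = if S = T then 1 else 0 := by
    intro S T
    simp only [v, Finset.prod_apply, qpoly_eval, H T.1 (hc T).le]
    split_ifs with h
    · subst h
      exact Finset.prod_eq_one fun x hx => if_pos hx
    · have : ¬ S.1 ⊆ T.1 := fun hs =>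
        h (Subtype.ext (Finset.eq_of_subset_of_card_le hs (by rw [hc, hc])))
      obtain ⟨x, hx, hx'⟩ := Finset.not_subset.1 this
      exact Finset.prod_eq_zero hx (if_neg hx')
  have hli : LinearIndependent (ZMod 2) v := by
    rw [Fintype.linearIndependent_iff]
    intro g hg T
    have := congrFun hg (φ T.1)
    rw [Finset.sum_apply, Fintype.sum_eq_single T] at this
    · simpa [hv] using this
    · intro S hS
      simp [hv, hS]
  let w := (lowSets s (2 * n)).image mono2
  have hspan : Set.range v ≤ Submodule.span (ZMod 2) (w : Set ((Fin s → Bool) → ZMod 2)) := by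
    rintro _ ⟨S, rfl⟩
    have := qprod_mem i₁ i₂ i₃ S.1
    rw [hc] at this
    simpa [w, lowSpan] using this
  have h1 := linearIndependent_le_span' v hli _ hspan
  have h2 : Fintype.card ι = m.choose n := by
    simp [ι]
  have h3 : m.choose n ≤ w.card := by
    simpa [h2] using h1
  exact h3.trans Finset.card_image_le

lemma card_lowSets_le (s d : ℕ) (hd : 0 < d) (hds : d ≤ s) :
    ((lowSets s d).card : ℝ) * ((d : ℝ) / s) ^ d ≤ Real.exp 1 ^ d := by
  have hs : (0 : ℝ) < s := by exact_mod_cast lt_of_lt_of_le hd hds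
  set t : ℝ := (d : ℝ) / s with ht
  have ht0 : 0 ≤ t := by positivity
  have ht1 : t ≤ 1 := by rw [ht, div_le_one hs]; exact_mod_cast hds
  calc ((lowSets s d).card : ℝ) * t ^ d = ∑ A ∈ lowSets s d, t ^ d := by simp
    _ ≤ ∑ A ∈ lowSets s d, t ^ A.card := by
        apply Finset.sum_le_sum
        intro A hA
        exact pow_le_pow_of_le_one ht0 ht1 (by simpa [lowSets] using hA)
    _ ≤ ∑ A : Finset (Fin s), t ^ A.card :=
        Finset.sum_le_sum_of_subset_of_nonneg (Finset.subset_univ _)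
          (fun _ _ _ => by positivity)
    _ = (t + 1) ^ s := by
        have := Fin.sum_pow_mul_eq_add_pow t (1 : ℝ) (n := s)
        simpa using this
    _ ≤ Real.exp t ^ s := by
        gcongr
        exact Real.add_one_le_exp t
    _ = Real.exp 1 ^ d := by
        rw [← Real.exp_nat_mul, ← Real.exp_nat_mul, ht]
        congr 1
        field_simp

lemma choose_lower (m n : ℕ) (hn : 1 ≤ n) (hm : 900 * n ≤ m) :
    ((m : ℝ) / (2 * n)) ^ n ≤ m.choose n := by
  have h1 : (m + 1 - n) ^ n ≤ n.factorial * m.choose n := by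
    rw [← Nat.descFactorial_eq_factorial_mul_choose]
    exact Nat.pow_sub_le_descFactorial m n
  have h2 : n.factorial * m.choose n ≤ n ^ n * m.choose n :=
    Nat.mul_le_mul_right _ (Nat.factorial_le_pow n)
  have h3 : ((m : ℝ) / 2) ^ n ≤ (n : ℝ) ^ n * m.choose n := by
    have h4 : ((m : ℝ) / 2) ^ n ≤ ((m + 1 - n : ℕ) : ℝ) ^ n := by
      gcongr
      rw [div_le_iff₀ (by norm_num)]
      have : m ≤ (m + 1 - n) * 2 := by omega
      exact_mod_cast this
    exact h4.trans (by exact_mod_cast h1.trans h2)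
  have hn0 : (0 : ℝ) < n := by exact_mod_cast hn
  have h5 : (m : ℝ) / (2 * n) = (m / 2) / n := by field_simp
  rw [h5, div_pow, div_le_iff₀ (by positivity), mul_comm]
  exact h3

/-- For all `m` and all `n` with `1 ≤ n ≤ m/900`, every non-adaptive
`(m,n,s,3)`-scheme whose query function is `(x,y,z) ↦ (x∧y)⊕z` for every element
satisfies `s ≥ (3/(5e))·√(mn)`. -/
theorem and_xor_three_probe_lower_bound :
    ∀ m n s : ℕ, 1 ≤ n → (n : ℝ) ≤ (m : ℝ) / 900 →
    ∀ i₁ i₂ i₃ : Fin m → Fin s, ∀ φ : Finset (Fin m) → Fin s → Bool,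
      (∀ S : Finset (Fin m), S.card ≤ n → ∀ x : Fin m,
        ((xor (φ S (i₁ x) && φ S (i₂ x)) (φ S (i₃ x))) = true ↔ x ∈ S)) →
      (3 / (5 * Real.exp 1)) * Real.sqrt ((m : ℝ) * (n : ℝ)) ≤ (s : ℝ) := by
  intro m n s hn hmn i₁ i₂ i₃ φ H
  have hm : 900 * n ≤ m := by
    have : (900 : ℝ) * n ≤ m := by linarith
    exact_mod_cast this
  have hn0 : (0 : ℝ) < n := by exact_mod_cast hn
  have hlow := choose_lower m n hn hm
  have hup : (m.choose n : ℝ) ≤ (lowSets s (2 * n)).card := by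
    exact_mod_cast choose_le_lowSets m n s i₁ i₂ i₃ φ H
  have hs : 2 * n ≤ s := by
    by_contra hlt
    have h1 : (lowSets s (2 * n)).card ≤ 2 ^ (2 * n) := by
      calc (lowSets s (2 * n)).card ≤ 2 ^ s := by
            have := Finset.card_le_univ (lowSets s (2 * n))
            simpa using this
        _ ≤ 2 ^ (2 * n) := Nat.pow_le_pow_right (by norm_num) (by omega)
    have h2 : ((lowSets s (2 * n)).card : ℝ) ≤ 4 ^ n := by
      have h : ((lowSets s (2 * n)).card : ℝ) ≤ 2 ^ (2 * n) := by exact_mod_cast h1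
      rw [pow_mul] at h
      norm_num at h
      exact h
    have h3 : (4 : ℝ) ^ n < ((m : ℝ) / (2 * n)) ^ n := by
      apply pow_lt_pow_left₀ _ (by norm_num) (by omega)
      rw [lt_div_iff₀ (by positivity)]
      linarith
    linarith
  have hs0 : (0 : ℝ) < s := by
    have : 0 < s := by omega
    exact_mod_cast this
  have hcard := card_lowSets_le s (2 * n) (by omega) hs
  push_cast at hcard
  have he : 0 < Real.exp 1 := Real.exp_pos 1
  have hpow : ((m : ℝ) / (2 * n) * (2 * n / s) ^ 2) ^ n ≤ (Real.exp 1 ^ 2) ^ n := by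
    rw [mul_pow, ← pow_mul, ← pow_mul]
    refine le_trans ?_ hcard
    gcongr
    exact hlow.trans hup
  have hbase : (m : ℝ) / (2 * n) * (2 * n / s) ^ 2 ≤ Real.exp 1 ^ 2 :=
    le_of_pow_le_pow_left₀ (by omega) (by positivity) hpow
  have hb2 : 2 * (m * n : ℝ) ≤ Real.exp 1 ^ 2 * s ^ 2 := by
    have h : (m : ℝ) / (2 * n) * (2 * n / s) ^ 2 = 2 * (m * n) / s ^ 2 := by field_simp
    rw [h, div_le_iff₀ (by positivity)] at hbase
    exact hbase
  have hsq : Real.sqrt ((m : ℝ) * n) ≤ Real.exp 1 * s := by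
    apply Real.sqrt_le_iff.2 ⟨by positivity, ?_⟩
    have : (0 : ℝ) ≤ m * n := by positivity
    rw [mul_pow]
    linarith
  rw [div_mul_eq_mul_div, div_le_iff₀ (by positivity)]
  nlinarith [mul_pos he hs0]
end

section
/- There exist a constant α > 0 and m₀ such that for all m ≥ m₀ and all n with lg m ≤ n ≤ m/lg m, every non-adaptive (m,n,s,3)-scheme in which every query function equals (x,y,z) ↦ (x∧y)⊕z satisfies s ≥ α·√(m·n·lg(m/n)/lg lg m). -/
/-- Greedy hitting set. -/
lemma hit_lemma {ι κ : Type*} [DecidableEq ι] [Fintype κ] [Nonempty κ] [DecidableEq κ]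
    (Y : Finset ι) (E : ι → Finset κ) (δ : ℕ)
    (h : ∀ y ∈ Y, δ ≤ (E y).card) (k : ℕ) (hk : k * δ ≤ Fintype.card κ) :
    ∃ R : Finset κ, R.card ≤ k ∧
       k * δ * Y.card ≤ 2 * Fintype.card κ * (Y.filter (fun y => ∃ c ∈ R, c ∈ E y)).card := by
  induction k with
  | zero => exact ⟨∅, by simp, by simp⟩
  | succ k ih =>
    obtain ⟨R, hR, hh⟩ := ih (le_trans (Nat.mul_le_mul_right _ (Nat.le_succ k)) hk)
    by_cases h1 : Y.card ≤ 2 * (Y.filter (fun y => ∃ c ∈ R, c ∈ E y)).card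
    · refine ⟨R, by omega, ?_⟩
      calc (k+1) * δ * Y.card ≤ Fintype.card κ *
            (2 * (Y.filter (fun y => ∃ c ∈ R, c ∈ E y)).card) := Nat.mul_le_mul hk h1
        _ = _ := by ring
    set H := (Y.filter (fun y => ∃ c ∈ R, c ∈ E y)) with hH
    set W := Y.filter (fun y => ¬ ∃ c ∈ R, c ∈ E y) with hW
    have hsum : H.card + W.card = Y.card :=
      Finset.card_filter_add_card_filter_not _
    have hdc : δ * W.card ≤ ∑ c : κ, (W.filter (fun y => c ∈ E y)).card := by
      have e1 : ∑ c : κ, (W.filter (fun y => c ∈ E y)).card = ∑ y ∈ W, (E y).card := by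
        simp only [Finset.card_filter]
        rw [Finset.sum_comm]
        refine Finset.sum_congr rfl fun y _ => ?_
        simp
      rw [e1, mul_comm, ← smul_eq_mul]
      apply Finset.card_nsmul_le_sum
      intro y hy
      exact h y (Finset.mem_filter.1 hy).1
    have hex : ∃ c : κ, δ * W.card ≤ Fintype.card κ * (W.filter (fun y => c ∈ E y)).card := by
      by_contra hcon
      push Not at hcon
      have hlt : ∑ c : κ, Fintype.card κ * (W.filter (fun y => c ∈ E y)).card
          < ∑ c : κ, δ * W.card :=
        Finset.sum_lt_sum_of_nonempty Finset.univ_nonempty (fun c _ => hcon c)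
      rw [← Finset.mul_sum, Finset.sum_const, smul_eq_mul, Finset.card_univ] at hlt
      have := Nat.mul_le_mul_left (Fintype.card κ) hdc
      omega
    obtain ⟨c, hc⟩ := hex
    refine ⟨insert c R, (Finset.card_insert_le _ _).trans (by omega), ?_⟩
    have hsub : H ∪ (W.filter (fun y => c ∈ E y)) ⊆
        Y.filter (fun y => ∃ c' ∈ insert c R, c' ∈ E y) := by
      intro y hy
      simp only [hH, hW, Finset.mem_union, Finset.mem_filter, Finset.mem_insert] at hy ⊢
      rcases hy with ⟨hy, c', h1, h2⟩ | ⟨⟨hy, _⟩, h2⟩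
      · exact ⟨hy, c', Or.inr h1, h2⟩
      · exact ⟨hy, c, Or.inl rfl, h2⟩
    have hdisj : Disjoint H (W.filter (fun y => c ∈ E y)) := by
      apply Disjoint.mono_right (Finset.filter_subset _ _)
      exact Finset.disjoint_filter_filter_not _ _ _
    have hcard := Finset.card_le_card hsub
    rw [Finset.card_union_of_disjoint hdisj] at hcard
    have hW2 : Y.card ≤ 2 * W.card := by omega
    calc (k+1) * δ * Y.card = k * δ * Y.card + δ * Y.card := by ring
      _ ≤ 2 * Fintype.card κ * H.card + δ * (2 * W.card) :=
        Nat.add_le_add hh (Nat.mul_le_mul_left _ hW2)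
      _ ≤ 2 * Fintype.card κ * H.card +
          2 * (Fintype.card κ * (W.filter (fun y => c ∈ E y)).card) := by
        have := Nat.mul_le_mul_left 2 hc
        linarith
      _ = 2 * Fintype.card κ * (H.card + (W.filter (fun y => c ∈ E y)).card) := by ring
      _ ≤ _ := Nat.mul_le_mul_left _ hcard
/-- Packing: many good elements yield a gadget avoiding a small used set. -/
lemma packing_lemma {ι V : Type*} [DecidableEq ι] [DecidableEq V]
    (a b : ι → V) (E : ι → Prop) (Y X : Finset ι) (j : ℕ)
    (hX : X.card ≤ 3 * j) (hY : 9 * j < Y.card)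
    (hE : ∀ y ∈ Y, E y)
    (hga : ∀ y ∈ Y, ∃ x, E x ∧ x ≠ y ∧ (a x = a y ∨ b x = a y))
    (hgb : ∀ y ∈ Y, ∃ x, E x ∧ x ≠ y ∧ (a x = b y ∨ b x = b y)) :
    ∃ x1 x2 x3, x1 ∉ X ∧ x2 ∉ X ∧ x3 ∉ X ∧ E x1 ∧ E x2 ∧ E x3 ∧ x1 ≠ x2 ∧ x3 ≠ x2 ∧
      (a x1 = a x2 ∨ b x1 = a x2) ∧ (a x3 = b x2 ∨ b x3 = b x2) := by
  by_contra hcon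
  have key : ∀ y ∈ Y \ X, ∃ v ∈ X.image a ∪ X.image b, (a y = v ∨ b y = v) ∧
      ∀ x, E x → x ∉ X → (a x = v ∨ b x = v) → x = y := by
    intro y hy
    rw [Finset.mem_sdiff] at hy
    obtain ⟨x1, e1, n1, h1⟩ := hga y hy.1
    obtain ⟨x3, e3, n3, h3⟩ := hgb y hy.1
    by_cases ca : ∃ x, x ∉ X ∧ E x ∧ x ≠ y ∧ (a x = a y ∨ b x = a y)
    · by_cases cb : ∃ x, x ∉ X ∧ E x ∧ x ≠ y ∧ (a x = b y ∨ b x = b y)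
      · obtain ⟨u, u1, u2, u3, u4⟩ := ca
        obtain ⟨w, w1, w2, w3, w4⟩ := cb
        exact absurd ⟨u, y, w, u1, hy.2, w1, u2, hE y hy.1, w2, u3, w3, u4, w4⟩ hcon
      · push Not at cb
        refine ⟨b y, ?_, Or.inr rfl, ?_⟩
        · have : x3 ∈ X := by
            by_contra hx
            have := cb x3 hx e3 n3
            tauto
          rw [Finset.mem_union, Finset.mem_image, Finset.mem_image]
          rcases h3 with h | h
          · exact Or.inl ⟨x3, this, h⟩
          · exact Or.inr ⟨x3, this, h⟩
        · intro x hx1 hx2 hx3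
          by_contra hne
          have := cb x hx2 hx1 hne
          tauto
    · push Not at ca
      refine ⟨a y, ?_, Or.inl rfl, ?_⟩
      · have : x1 ∈ X := by
          by_contra hx
          have := ca x1 hx e1 n1
          tauto
        rw [Finset.mem_union, Finset.mem_image, Finset.mem_image]
        rcases h1 with h | h
        · exact Or.inl ⟨x1, this, h⟩
        · exact Or.inr ⟨x1, this, h⟩
      · intro x hx1 hx2 hx3
        by_contra hne
        have := ca x hx2 hx1 hne
        tauto
  have hle : (Y \ X).card ≤ (X.image a ∪ X.image b).card := by
    have key' : ∀ y, ∃ v, y ∈ Y \ X → v ∈ X.image a ∪ X.image b ∧ (a y = v ∨ b y = v) ∧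
      ∀ x, E x → x ∉ X → (a x = v ∨ b x = v) → x = y := by
      intro y
      by_cases hy : y ∈ Y \ X
      · obtain ⟨v, hv⟩ := key y hy
        exact ⟨v, fun _ => hv⟩
      · exact ⟨a y, fun h => absurd h hy⟩
    choose f hf using key'
    apply Finset.card_le_card_of_injOn f
    · intro y hy
      exact (hf y hy).1
    · intro y hy y' hy' hyy
      have h1 := hf y hy
      have h2 := (hf y' hy').2.2 y (hE y (Finset.mem_sdiff.1 hy).1) (Finset.mem_sdiff.1 hy).2
      rw [← hyy] at h2
      exact h2 h1.2.1
  have h1 : (X.image a ∪ X.image b).card ≤ X.card + X.card :=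
    (Finset.card_union_le _ _).trans (Nat.add_le_add Finset.card_image_le Finset.card_image_le)
  have h2 : Y.card ≤ (Y \ X).card + X.card := by
    have := Finset.le_card_sdiff X Y
    omega
  omega
/-- Each gadget kills an eighth of the colour patterns. -/
lemma kill_lemma {ι V : Type*} [DecidableEq ι] [DecidableEq V]
    (a b c : ι → V) (C : Finset V) (Y : Finset ι) (t : ℕ) (hY : 9 * t ≤ Y.card)
    (hE : ∀ y ∈ Y, c y ∈ C)
    (hga : ∀ y ∈ Y, ∃ x, c x ∈ C ∧ x ≠ y ∧ (a x = a y ∨ b x = a y))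
    (hgb : ∀ y ∈ Y, ∃ x, c x ∈ C ∧ x ≠ y ∧ (a x = b y ∨ b x = b y)) (j : ℕ) (hj : j ≤ t) :
    ∃ (X S : Finset ι) (A : Finset (Finset V)), S ⊆ X ∧ X.card ≤ 3 * j ∧
      8 ^ j * A.card ≤ 7 ^ j * 2 ^ C.card ∧
      ∀ y : V → Bool, (∀ x ∈ X, (xor (y (a x) && y (b x)) (y (c x)) = true ↔ x ∈ S)) →
        C.filter (fun v => y v = true) ∈ A := by
  induction j with
  | zero =>
    refine ⟨∅, ∅, C.powerset, by simp, by simp, by simp, ?_⟩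
    intro y _
    simp
  | succ j ih =>
    obtain ⟨X, S, A, hSX, hX, hA, hy⟩ := ih (by omega)
    obtain ⟨x1, x2, x3, n1, n2, n3, e1, e2, e3, d1, d3, g1, g3⟩ :=
      packing_lemma a b (fun x => c x ∈ C) Y X j hX (by omega) hE hga hgb
    let g : Finset V → Bool × Bool × Bool := fun τ =>
      (decide (c x1 ∈ τ), decide (c x2 ∈ τ), decide (c x3 ∈ τ))
    have hpig : ∃ p : Bool × Bool × Bool, A.card ≤ 8 * (A.filter (fun τ => g τ = p)).card := by
      by_contra hcon
      push Not at hcon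
      have h1 : A.card = ∑ p : Bool × Bool × Bool, (A.filter (fun τ => g τ = p)).card :=
        Finset.card_eq_sum_card_fiberwise (fun _ _ => Finset.mem_univ _)
      have h2 : ∑ p : Bool × Bool × Bool, 8 * (A.filter (fun τ => g τ = p)).card <
          ∑ p : Bool × Bool × Bool, A.card :=
        Finset.sum_lt_sum_of_nonempty Finset.univ_nonempty (fun p _ => hcon p)
      rw [← Finset.mul_sum, ← h1, Finset.sum_const] at h2
      simp at h2
    obtain ⟨⟨p1, p2, p3⟩, hp⟩ := hpig
    let q : ι → Bool := fun x => if x = x1 then !p1 else if x = x2 then p2 else !p3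
    -- consistent requirement when x1 = x3 has p1 = p3 (else nothing agrees)
    refine ⟨X ∪ {x1, x2, x3}, S ∪ ({x1, x2, x3} : Finset ι).filter (fun x => q x = true),
      A.filter (fun τ => ¬ g τ = (p1, p2, p3)), ?_, ?_, ?_, ?_⟩
    · exact Finset.union_subset_union hSX (Finset.filter_subset _ _)
    · have h3 : ({x1, x2, x3} : Finset ι).card ≤ 3 := Finset.card_le_three
      have := Finset.card_union_le X {x1, x2, x3}
      omega
    · have := Finset.card_filter_add_card_filter_not (s := A) (fun τ => g τ = (p1, p2, p3))
      have h7 : 8 * (A.filter (fun τ => ¬ g τ = (p1, p2, p3))).card ≤ 7 * A.card := by omega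
      calc 8 ^ (j+1) * (A.filter (fun τ => ¬ g τ = (p1, p2, p3))).card
          = 8 ^ j * (8 * (A.filter (fun τ => ¬ g τ = (p1, p2, p3))).card) := by ring
        _ ≤ 8 ^ j * (7 * A.card) := Nat.mul_le_mul_left _ h7
        _ = 7 * (8 ^ j * A.card) := by ring
        _ ≤ 7 * (7 ^ j * 2 ^ C.card) := Nat.mul_le_mul_left _ hA
        _ = _ := by ring
    · intro y hyy
      rw [Finset.mem_filter]
      constructor
      · apply hy
        intro x hx
        rw [hyy x (Finset.mem_union_left _ hx), Finset.mem_union, Finset.mem_filter]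
        constructor
        · rintro (h | ⟨h, _⟩)
          · exact h
          · simp only [Finset.mem_insert, Finset.mem_singleton] at h
            rcases h with rfl | rfl | rfl <;> contradiction
        · exact Or.inl
      · intro hg
        simp only [g, Finset.mem_filter, e1, e2, e3, true_and, Prod.mk.injEq,
          Bool.decide_eq_true] at hg
        obtain ⟨r1, r2, r3⟩ := hg
        have k1 := hyy x1 (by simp)
        have k2 := hyy x2 (by simp)
        have k3 := hyy x3 (by simp)
        have m1 : x1 ∉ S := fun h => n1 (hSX h)
        have m2 : x2 ∉ S := fun h => n2 (hSX h)
        have m3 : x3 ∉ S := fun h => n3 (hSX h)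
        have q1 : q x1 = !p1 := by simp [q]
        have q2 : q x2 = p2 := by simp [q, d1.symm]
        have q3 : q x3 = !p3 := by
          by_cases h31 : x3 = x1
          · simp only [q, h31, if_true]
            rw [← r1, ← r3, h31]
          · simp [q, h31, d3]
        simp only [Finset.mem_union, m1, m2, m3, Finset.mem_filter, Finset.mem_insert,
          Finset.mem_singleton, true_or, or_true, true_and, false_or, q1, q2, q3] at k1 k2 k3
        rw [← r1] at k1
        rw [← r2] at k2
        rw [← r3] at k3
        have z1 : y (a x2) = true := by
          have : y (a x1) = true ∧ y (b x1) = true := by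
            revert k1
            cases y (a x1) <;> cases y (b x1) <;> cases y (c x1) <;> simp
          rcases g1 with h | h
          · rw [← h]; exact this.1
          · rw [← h]; exact this.2
        have z3 : y (b x2) = true := by
          have : y (a x3) = true ∧ y (b x3) = true := by
            revert k3
            cases y (a x3) <;> cases y (b x3) <;> cases y (c x3) <;> simp
          rcases g3 with h | h
          · rw [← h]; exact this.1
          · rw [← h]; exact this.2
        rw [z1, z3] at k2
        revert k2
        cases y (c x2) <;> simp
/-- Colours of other elements meeting cell `v` (everything, if `y` itself can be certified). -/
def occColors {ι V : Type*} [Fintype ι] [DecidableEq ι] [Fintype V] [DecidableEq V]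
    (a b c : ι → V) (y : ι) (v : V) : Finset V :=
  if c y ∈ ((Finset.univ.filter (fun x => a x = v ∨ b x = v)).erase y).image c then Finset.univ
  else ((Finset.univ.filter (fun x => a x = v ∨ b x = v)).erase y).image c

lemma occColors_use {ι V : Type*} [Fintype ι] [DecidableEq ι] [Fintype V] [DecidableEq V]
    (a b c : ι → V) (y : ι) (v : V) (C : Finset V) (hy : c y ∈ C) (r : V) (hr : r ∈ C)
    (h : r ∈ occColors a b c y v) : ∃ x, c x ∈ C ∧ x ≠ y ∧ (a x = v ∨ b x = v) := by
  unfold occColors at h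
  split_ifs at h with h1
  · obtain ⟨x, hx, hc⟩ := Finset.mem_image.1 h1
    simp only [Finset.mem_erase, Finset.mem_filter, Finset.mem_univ, true_and] at hx
    exact ⟨x, hc ▸ hy, hx.1, hx.2⟩
  · obtain ⟨x, hx, hc⟩ := Finset.mem_image.1 h
    simp only [Finset.mem_erase, Finset.mem_filter, Finset.mem_univ, true_and] at hx
    exact ⟨x, hc ▸ hr, hx.1, hx.2⟩

lemma bad_card {ι V : Type*} [Fintype ι] [DecidableEq ι] [Fintype V] [DecidableEq V]
    (a b c : ι → V) (D : ℕ) (hD : D ≤ Fintype.card V) :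
    (Finset.univ.filter (fun y => ¬ (D ≤ (occColors a b c y (a y)).card ∧
      D ≤ (occColors a b c y (b y)).card))).card ≤ Fintype.card V * D := by
  set Z := Finset.univ.filter (fun y => ¬ (D ≤ (occColors a b c y (a y)).card ∧
      D ≤ (occColors a b c y (b y)).card)) with hZ
  let N : V → Finset ι := fun v => Finset.univ.filter (fun x => a x = v ∨ b x = v)
  have key : ∀ y, ∃ v, y ∈ Z → (y ∈ N v ∧ c y ∉ ((N v).erase y).image c ∧
      ((N v).image c).card ≤ D) := by
    intro y
    by_cases hy : y ∈ Z
    · have hv : ∃ v, y ∈ N v ∧ (occColors a b c y v).card < D := by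
        simp only [hZ, Finset.mem_filter, Finset.mem_univ, true_and, not_and_or, not_le] at hy
        rcases hy with h | h
        · exact ⟨a y, by simp [N], h⟩
        · exact ⟨b y, by simp [N], h⟩
      obtain ⟨v, hv, hlt⟩ := hv
      refine ⟨v, fun _ => ⟨hv, ?_⟩⟩
      unfold occColors at hlt
      split_ifs at hlt with h1
      · rw [Finset.card_univ] at hlt
        omega
      · refine ⟨h1, ?_⟩
        have : (N v).image c = insert (c y) (((N v).erase y).image c) := by
          rw [← Finset.image_insert, Finset.insert_erase hv]
        rw [this]
        exact (Finset.card_insert_le _ _).trans hlt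
    · exact ⟨a y, fun h => absurd h hy⟩
  choose f hf using key
  let T : Finset (V × V) := (Finset.univ.filter (fun v => ((N v).image c).card ≤ D)).biUnion
    (fun v => ((N v).image c).image (fun u => (v, u)))
  have hT : T.card ≤ Fintype.card V * D := by
    refine (Finset.card_biUnion_le_card_mul _ _ D ?_).trans ?_
    · intro v hv
      exact Finset.card_image_le.trans (Finset.mem_filter.1 hv).2
    · exact Nat.mul_le_mul_right _ (Finset.card_le_univ _)
  refine le_trans (Finset.card_le_card_of_injOn (fun y => (f y, c y)) ?_ ?_) hT
  · intro y hy
    obtain ⟨h1, h2, h3⟩ := hf y hy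
    have : (f y, c y) ∈ T := by
      simp only [T, Finset.mem_biUnion, Finset.mem_filter, Finset.mem_univ, true_and]
      exact ⟨f y, h3, Finset.mem_image_of_mem _ (Finset.mem_image_of_mem _ h1)⟩
    exact this
  · intro y hy y' hy' hyy
    by_contra hne
    simp only [Prod.mk.injEq] at hyy
    obtain ⟨h1, h2, h3⟩ := hf y hy
    obtain ⟨h1', h2', h3'⟩ := hf y' hy'
    apply h2
    rw [hyy.2]
    apply Finset.mem_image_of_mem
    rw [Finset.mem_erase]
    refine ⟨fun h => hne h.symm, ?_⟩
    rw [hyy.1]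
    exact h1'

lemma core_lemma {ι V : Type*} [Fintype ι] [DecidableEq ι] [Fintype V] [Nonempty V]
    [DecidableEq V] (a b c : ι → V) (n k D : ℕ) (hk : 1 ≤ k) (hn : 54 * k ≤ n)
    (hks : k ≤ Fintype.card V) (hkD : k * D ≤ Fintype.card V)
    (hDm : 2 * Fintype.card V * D ≤ Fintype.card ι)
    (hmain : 2592 * Fintype.card V ^ 3 ≤ k ^ 2 * D ^ 2 * Fintype.card ι)
    (φ : Finset ι → V → Bool)
    (hφ : ∀ S : Finset ι, S.card ≤ n → ∀ x : ι,
        ((xor (φ S (a x) && φ S (b x)) (φ S (c x))) = true ↔ x ∈ S)) : False := by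
  have hD : D ≤ Fintype.card V := le_trans (Nat.le_mul_of_pos_left D hk) hkD
  have hbad := bad_card a b c D hD
  have hsum := Finset.card_filter_add_card_filter_not (s := (Finset.univ : Finset ι))
    (fun y => D ≤ (occColors a b c y (a y)).card ∧ D ≤ (occColors a b c y (b y)).card)
  rw [Finset.card_univ] at hsum
  set Y0 := Finset.univ.filter (fun y => D ≤ (occColors a b c y (a y)).card ∧
    D ≤ (occColors a b c y (b y)).card) with hY0
  have h0 : Fintype.card ι ≤ 2 * Y0.card := by
    have : 2 * Fintype.card V * D = 2 * (Fintype.card V * D) := by ring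
    omega
  obtain ⟨R1, c1, h1⟩ := hit_lemma Y0 (fun y => occColors a b c y (a y)) D
    (fun y hy => (Finset.mem_filter.1 hy).2.1) k hkD
  set Y1 := Y0.filter (fun y => ∃ r ∈ R1, r ∈ occColors a b c y (a y)) with hY1
  obtain ⟨R2, c2, h2⟩ := hit_lemma Y1 (fun y => occColors a b c y (b y)) D
    (fun y hy => (Finset.mem_filter.1 (Finset.mem_filter.1 hy).1).2.2) k hkD
  set Y2 := Y1.filter (fun y => ∃ r ∈ R2, r ∈ occColors a b c y (b y)) with hY2
  obtain ⟨R3, c3, h3⟩ := hit_lemma Y2 (fun y => {c y}) 1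
    (fun y _ => by simp) k (by simpa using hks)
  set Y3 := Y2.filter (fun y => ∃ r ∈ R3, r ∈ ({c y} : Finset V)) with hY3
  have hspos : 0 < Fintype.card V := Fintype.card_pos
  have hbig : 9 * (18 * k) ≤ Y3.card := by
    set s := Fintype.card V
    have e : 16 * s ^ 3 * (9 * (18 * k)) ≤ 16 * s ^ 3 * Y3.card := by
      calc 16 * s ^ 3 * (9 * (18 * k)) = k * (2592 * s ^ 3) := by ring
        _ ≤ k * (k ^ 2 * D ^ 2 * Fintype.card ι) := Nat.mul_le_mul_left _ hmain
        _ ≤ k * (k ^ 2 * D ^ 2 * (2 * Y0.card)) := by gcongr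
        _ = 2 * k * (k * D) * (k * D * Y0.card) := by ring
        _ ≤ 2 * k * (k * D) * (2 * s * Y1.card) := Nat.mul_le_mul_left _ h1
        _ = 4 * k * s * (k * D * Y1.card) := by ring
        _ ≤ 4 * k * s * (2 * s * Y2.card) := Nat.mul_le_mul_left _ h2
        _ = 8 * s ^ 2 * (k * 1 * Y2.card) := by ring
        _ ≤ 8 * s ^ 2 * (2 * s * Y3.card) := Nat.mul_le_mul_left _ h3
        _ = 16 * s ^ 3 * Y3.card := by ring
    exact Nat.le_of_mul_le_mul_left e (by positivity)
  set C := R1 ∪ R2 ∪ R3 with hC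
  have hCc : C.card ≤ 3 * k := by
    have := Finset.card_union_le (R1 ∪ R2) R3
    have := Finset.card_union_le R1 R2
    rw [hC]
    omega
  have hE : ∀ y ∈ Y3, c y ∈ C := by
    intro y hy
    obtain ⟨r, hr, hr'⟩ := (Finset.mem_filter.1 hy).2
    rw [Finset.mem_singleton] at hr'
    rw [← hr']
    exact Finset.mem_union_right _ hr
  have hga : ∀ y ∈ Y3, ∃ x, c x ∈ C ∧ x ≠ y ∧ (a x = a y ∨ b x = a y) := by
    intro y hy
    have hy2 := (Finset.mem_filter.1 hy).1
    have hy1 := (Finset.mem_filter.1 hy2).1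
    obtain ⟨r, hr, hr'⟩ := (Finset.mem_filter.1 hy1).2
    exact occColors_use a b c y (a y) C (hE y hy) r
      (Finset.mem_union_left _ (Finset.mem_union_left _ hr)) hr'
  have hgb : ∀ y ∈ Y3, ∃ x, c x ∈ C ∧ x ≠ y ∧ (a x = b y ∨ b x = b y) := by
    intro y hy
    have hy2 := (Finset.mem_filter.1 hy).1
    obtain ⟨r, hr, hr'⟩ := (Finset.mem_filter.1 hy2).2
    exact occColors_use a b c y (b y) C (hE y hy) r
      (Finset.mem_union_left _ (Finset.mem_union_right _ hr)) hr'
  obtain ⟨X, S, A, hSX, hX, hA, hkill⟩ :=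
    kill_lemma a b c C Y3 (18 * k) hbig hE hga hgb (18 * k) le_rfl
  have hmem := hkill (φ S) (fun x _ => hφ S (by
    have := Finset.card_le_card hSX
    omega) x)
  have hApos : 1 ≤ A.card := Finset.card_pos.2 ⟨_, hmem⟩
  have h8 : 8 ^ (18 * k) ≤ 7 ^ (18 * k) * 2 ^ (3 * k) := by
    calc 8 ^ (18 * k) ≤ 8 ^ (18 * k) * A.card := Nat.le_mul_of_pos_right _ hApos
      _ ≤ _ := hA
      _ ≤ _ := Nat.mul_le_mul_left _ (Nat.pow_le_pow_right (by norm_num) hCc)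
  rw [pow_mul, pow_mul, pow_mul, ← mul_pow] at h8
  have := Nat.pow_lt_pow_left (show 7 ^ 18 * 2 ^ 3 < 8 ^ 18 by norm_num) (show k ≠ 0 by omega)
  omega

lemma core_fin {m s s' : ℕ} (hs : s ≤ s') (i₁ i₂ i₃ : Fin m → Fin s)
    (φ : Finset (Fin m) → Fin s → Bool) (n k D : ℕ) (hk : 1 ≤ k) (hn : 54 * k ≤ n)
    (hks : k ≤ s') (hkD : k * D ≤ s') (hDm : 2 * s' * D ≤ m)
    (hmain : 2592 * s' ^ 3 ≤ k ^ 2 * D ^ 2 * m)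
    (hφ : ∀ S : Finset (Fin m), S.card ≤ n → ∀ x : Fin m,
        ((xor (φ S (i₁ x) && φ S (i₂ x)) (φ S (i₃ x))) = true ↔ x ∈ S)) : False := by
  have : Nonempty (Fin s') := ⟨⟨0, by omega⟩⟩
  refine core_lemma (ι := Fin m) (V := Fin s') (fun x => Fin.castLE hs (i₁ x))
    (fun x => Fin.castLE hs (i₂ x)) (fun x => Fin.castLE hs (i₃ x)) n k D hk hn
    (by simpa using hks) (by simpa using hkD) (by simpa using hDm) (by simpa using hmain)
    (fun S j => if h : j.1 < s then φ S ⟨j.1, h⟩ else false) ?_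
  intro S hS x
  have := hφ S hS x
  simpa using this
lemma numeric_lemma (m n : ℕ) (K w : ℝ) (hn : 108 ≤ n) (hK : 1 ≤ K)
    (hbig : 3 * 10 ^ 10 * K ^ 5 * (n : ℝ) ≤ m) (hw : 0 ≤ w) (hw2 : w ^ 2 = m * n * K) :
    ∃ k D : ℕ, 1 ≤ k ∧ 54 * k ≤ n ∧ k ≤ ⌈w / 10⌉₊ ∧ k * D ≤ ⌈w / 10⌉₊ ∧
      2 * ⌈w / 10⌉₊ * D ≤ m ∧ 2592 * ⌈w / 10⌉₊ ^ 3 ≤ k ^ 2 * D ^ 2 * m := by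
  have hN : (108 : ℝ) ≤ n := by exact_mod_cast hn
  have hNpos : (0 : ℝ) < n := by linarith
  have hK5 : K ≤ K ^ 5 := le_self_pow₀ hK (by norm_num)
  have hMK : 3 * 10 ^ 10 * (K * n) ≤ m := by
    have := mul_le_mul_of_nonneg_right hK5 hNpos.le
    nlinarith
  have hKn : (n : ℝ) ≤ K * n := le_mul_of_one_le_left hNpos.le hK
  have hMpos : (0 : ℝ) < m := by nlinarith
  have hMN : (n : ℝ) ≤ m := by nlinarith
  -- size of w
  have hwn : (n : ℝ) ≤ w := by
    apply le_of_sq_le_sq _ hw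
    rw [hw2]
    nlinarith
  have hwm : 1000 * w ≤ m := by
    apply le_of_sq_le_sq _ hMpos.le
    have : (1000 * w) ^ 2 = 10 ^ 6 * (m * (K * n)) := by rw [mul_pow, hw2]; ring
    rw [this]
    nlinarith
  set s := ⌈w / 10⌉₊ with hs
  have hs1 : w / 10 ≤ s := Nat.le_ceil _
  have hs2 : (s : ℝ) ≤ w / 5 := by
    have := Nat.ceil_lt_add_one (show 0 ≤ w / 10 by positivity)
    have h10 : 1 ≤ w / 10 := by linarith
    linarith
  have hspos : (0 : ℝ) < s := by linarith
  have hspos' : 0 < s := by exact_mod_cast hspos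
  have hss : (m : ℝ) * n ≤ 100 * (s : ℝ) ^ 2 := by
    have : w ^ 2 ≤ (10 * (s : ℝ)) ^ 2 := by
      apply pow_le_pow_left₀ hw; linarith
    rw [hw2] at this
    have h2 : (m : ℝ) * n ≤ m * n * K := le_mul_of_one_le_right (by positivity) hK
    nlinarith
  have hk2 : 54 * (n / 54) ≤ n := Nat.mul_div_le n 54
  have hk3 : n ≤ 108 * (n / 54) := by omega
  have hD2 : 2 * s * (m / (2 * s)) ≤ m := Nat.mul_div_le m (2 * s)
  have hsm : 2 * s ≤ m := by
    have : (2 * s : ℝ) ≤ m := by linarith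
    exact_mod_cast this
  have hD3 : m ≤ 4 * s * (m / (2 * s)) := by
    have h1 := Nat.div_add_mod m (2 * s)
    have h2 := Nat.mod_lt m (show 2 * s > 0 by omega)
    have h3 : 1 ≤ m / (2 * s) := (Nat.one_le_div_iff (by omega)).2 hsm
    have h4 := Nat.mul_le_mul_left (2 * s) h3
    have h5 : 4 * s * (m / (2 * s)) = 2 * (2 * s * (m / (2 * s))) := by ring
    omega
  generalize n / 54 = k at hk2 hk3
  generalize m / (2 * s) = D at hD2 hD3
  have rk2 : 54 * (k : ℝ) ≤ n := by exact_mod_cast hk2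
  have rk3 : (n : ℝ) ≤ 108 * k := by exact_mod_cast hk3
  have rD2 : 2 * (s : ℝ) * D ≤ m := by exact_mod_cast hD2
  have rD3 : (m : ℝ) ≤ 4 * s * D := by exact_mod_cast hD3
  refine ⟨k, D, by omega, hk2, ?_, ?_, hD2, ?_⟩
  · have : (k : ℝ) ≤ s := by linarith
    exact_mod_cast this
  · have : (k : ℝ) * D ≤ s := by
      have h1 : (54 * (k : ℝ)) * (2 * s * D) ≤ n * m :=
        mul_le_mul rk2 rD2 (by positivity) hNpos.le
      have h2 : (108 * (s : ℝ)) * (k * D) ≤ (108 * s) * s := by nlinarith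
      exact le_of_mul_le_mul_left h2 (by positivity)
    exact_mod_cast this
  · have : 2592 * (s : ℝ) ^ 3 ≤ k ^ 2 * D ^ 2 * m := by
      have h5 : (s : ℝ) ^ 5 ≤ (w / 5) ^ 5 := pow_le_pow_left₀ hspos.le hs2 5
      have hC : 154800 * w ^ 5 ≤ (n : ℝ) ^ 2 * m ^ 3 := by
        apply le_of_sq_le_sq _ (by positivity)
        have e1 : (154800 * w ^ 5) ^ 2 = 154800 ^ 2 * (m * n * K) ^ 5 := by
          rw [← hw2]; ring
        rw [e1]
        calc (154800 : ℝ) ^ 2 * (m * n * K) ^ 5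
            = (m : ℝ) ^ 5 * (n : ℝ) ^ 4 * (154800 ^ 2 * (K ^ 5 * n)) := by ring
          _ ≤ (m : ℝ) ^ 5 * (n : ℝ) ^ 4 * m := by
              apply mul_le_mul_of_nonneg_left _ (by positivity)
              have : 0 ≤ K ^ 5 * (n : ℝ) := by positivity
              nlinarith
          _ = ((n : ℝ) ^ 2 * m ^ 3) ^ 2 := by ring
      have h6 : 483729408 * (s : ℝ) ^ 5 ≤ (n : ℝ) ^ 2 * m ^ 3 := by
        have hw5 : 0 ≤ w ^ 5 := by positivity
        have : (w / 5) ^ 5 = w ^ 5 / 3125 := by ring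
        rw [this] at h5
        linarith
      have h7 : (n : ℝ) ^ 2 * m ^ 3 ≤ (108 * k) ^ 2 * ((4 * s * D) ^ 2 * m) := by
        have : (n : ℝ) ^ 2 * m ^ 3 = n ^ 2 * (m ^ 2 * m) := by ring
        rw [this]
        gcongr
      have h8 : (186624 * (s : ℝ) ^ 2) * (2592 * (s : ℝ) ^ 3) ≤
          (186624 * (s : ℝ) ^ 2) * (k ^ 2 * D ^ 2 * m) := by
        calc (186624 * (s : ℝ) ^ 2) * (2592 * (s : ℝ) ^ 3) = 483729408 * (s : ℝ) ^ 5 := by ring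
          _ ≤ _ := h6.trans h7
          _ = _ := by ring
      exact le_of_mul_le_mul_left h8 (by positivity)
    exact_mod_cast this

lemma exists_threshold : ∃ R : ℝ, 108 ≤ R ∧ ∀ r : ℝ, R ≤ r →
    3 * 10 ^ 10 * (Real.logb 2 r) ^ 5 ≤ r := by
  have hl2 : 0 < Real.log 2 := Real.log_pos (by norm_num)
  have h := (Real.isLittleO_pow_log_id_atTop (n := 5)).def
    (show 0 < (Real.log 2) ^ 5 / (3 * 10 ^ 10) by positivity)
  obtain ⟨R, hR⟩ := Filter.eventually_atTop.1 h
  refine ⟨max R 108, le_max_right _ _, fun r hr => ?_⟩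
  have h1 := hR r ((le_max_left _ _).trans hr)
  have hr0 : 0 < r := by linarith [le_max_right R 108]
  have hlog : 0 ≤ Real.log r := Real.log_nonneg (by linarith [le_max_right R 108])
  simp only [id, Real.norm_eq_abs] at h1
  rw [abs_of_nonneg (pow_nonneg hlog 5), abs_of_pos hr0] at h1
  rw [Real.logb, div_pow]
  rw [mul_div_assoc', div_le_iff₀ (by positivity)]
  have : Real.log 2 ^ 5 / (3 * 10 ^ 10) * r = (r * Real.log 2 ^ 5) / (3 * 10 ^ 10) := by ring
  rw [this, le_div_iff₀ (by positivity)] at h1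
  linarith

/-- There exist a constant `α > 0` and `m₀` such that for all `m ≥ m₀`
and all `n` with `lg m ≤ n ≤ m / lg m`, every non-adaptive `(m,n,s,3)`-scheme whose
query function is `(x,y,z) ↦ (x∧y)⊕z` for every element satisfies
`s ≥ α·√(m·n·lg(m/n)/lg lg m)`. -/
theorem and_xor_three_probe_improved_lower_bound :
    ∃ α : ℝ, 0 < α ∧
    ∃ m₀ : ℕ, ∀ m : ℕ, m₀ ≤ m →
    ∀ n : ℕ, Real.logb 2 (m : ℝ) ≤ (n : ℝ) → (n : ℝ) ≤ (m : ℝ) / Real.logb 2 (m : ℝ) →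
    ∀ s : ℕ, ∀ i₁ i₂ i₃ : Fin m → Fin s, ∀ φ : Finset (Fin m) → Fin s → Bool,
      (∀ S : Finset (Fin m), S.card ≤ n → ∀ x : Fin m,
        ((xor (φ S (i₁ x) && φ S (i₂ x)) (φ S (i₃ x))) = true ↔ x ∈ S)) →
      α * Real.sqrt ((m : ℝ) * (n : ℝ) * Real.logb 2 ((m : ℝ) / (n : ℝ)) /
          Real.logb 2 (Real.logb 2 (m : ℝ))) ≤ (s : ℝ) := by
  obtain ⟨R, hR108, hR⟩ := exists_threshold
  refine ⟨1 / 10, by norm_num, ?_⟩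
  have hev : ∀ᶠ m : ℕ in Filter.atTop, R ≤ Real.logb 2 (m : ℝ) :=
    ((Real.tendsto_logb_atTop (by norm_num)).comp
      tendsto_natCast_atTop_atTop).eventually_ge_atTop R
  obtain ⟨m₀, hm₀⟩ := Filter.eventually_atTop.1 hev
  refine ⟨m₀, fun m hm n hn1 hn2 s i₁ i₂ i₃ φ hφ => ?_⟩
  have hlg := hm₀ m hm
  set lg := Real.logb 2 (m : ℝ) with hlgdef
  have hlgpos : 0 < lg := by linarith
  have hN : (108 : ℝ) ≤ n := by linarith
  have hNpos : (0 : ℝ) < n := by linarith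
  have hr : lg ≤ (m : ℝ) / n := by
    rw [le_div_iff₀ hlgpos] at hn2
    rw [le_div_iff₀ hNpos]
    linarith
  set L := Real.logb 2 ((m : ℝ) / n) with hL
  set l := Real.logb 2 lg with hl
  have hl1 : 1 ≤ l := by
    rw [hl, Real.le_logb_iff_rpow_le (by norm_num) hlgpos]
    norm_num
    linarith
  have hlL : l ≤ L := Real.logb_le_logb_of_le (by norm_num) hlgpos hr
  have hK1 : 1 ≤ L / l := by
    rw [le_div_iff₀ (by linarith)]
    linarith
  have hKL : L / l ≤ L := div_le_self (by linarith) hl1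
  have hbig0 := hR ((m : ℝ) / n) (by linarith)
  rw [← hL, le_div_iff₀ hNpos] at hbig0
  have hbig : 3 * 10 ^ 10 * (L / l) ^ 5 * (n : ℝ) ≤ m := by
    refine le_trans ?_ hbig0
    gcongr
  rw [mul_div_assoc]
  set w := Real.sqrt ((m : ℝ) * n * (L / l)) with hw
  have hw2 : w ^ 2 = m * n * (L / l) := Real.sq_sqrt (by positivity)
  by_contra hcon
  push Not at hcon
  obtain ⟨k, D, h1, h2, h3, h4, h5, h6⟩ := numeric_lemma m n (L / l) w
    (by exact_mod_cast hN) hK1 hbig (Real.sqrt_nonneg _) hw2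
  have hs : s ≤ ⌈w / 10⌉₊ := by
    have : (s : ℝ) ≤ ⌈w / 10⌉₊ := le_trans (by linarith) (Nat.le_ceil (w / 10))
    exact_mod_cast this
  exact core_fin hs i₁ i₂ i₃ φ n k D h1 h2 h3 h4 h5 h6 hφ
end

section
/- Let G be a finite simple graph with vertex set V and edge set E, and let d = 2|E|/|V| be its average degree. If d ≥ 2 and (d−1)^k > |V| for a positive integer k, then G contains a cycle of length at most 2k. -/
namespace MooreAux

open Finset

/-- Endpoints of non-backtracking walks that start with the step `u → v` and make `j` more steps. -/
def reach {V : Type*} [Fintype V] [DecidableEq V] (G : SimpleGraph V) [DecidableRel G.Adj] :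
    ℕ → V → V → Finset V
  | 0, _, v => {v}
  | j + 1, u, v => ((G.neighborFinset v).erase u).biUnion fun w => reach G j v w

theorem unique_walk {V : Type*} (G : SimpleGraph V) (k : ℕ)
    (hno : ∀ (v : V) (w : G.Walk v v), w.IsCycle → 2 * k < w.length)
    {u v : V} (p q : G.Walk u v) (hp : p.edges.IsChain (· ≠ ·)) (hq : q.edges.IsChain (· ≠ ·))
    (hpk : p.length ≤ k) (hqk : q.length ≤ k) : p = q := by
  classical
  let H : SimpleGraph V := SimpleGraph.fromEdgeSet {e | e ∈ p.edges ∨ e ∈ q.edges}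
  have hHG : H ≤ G := by
    intro a b hab
    rw [SimpleGraph.fromEdgeSet_adj] at hab
    rcases hab.1 with h | h
    · exact p.adj_of_mem_edges h
    · exact q.adj_of_mem_edges h
  have hpH : ∀ e ∈ p.edges, e ∈ H.edgeSet := by
    intro e he
    rw [SimpleGraph.edgeSet_fromEdgeSet]
    exact ⟨Or.inl he, G.not_isDiag_of_mem_edgeSet (p.edges_subset_edgeSet he)⟩
  have hqH : ∀ e ∈ q.edges, e ∈ H.edgeSet := by
    intro e he
    rw [SimpleGraph.edgeSet_fromEdgeSet]
    exact ⟨Or.inr he, G.not_isDiag_of_mem_edgeSet (q.edges_subset_edgeSet he)⟩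
  have hac : H.IsAcyclic := by
    intro a c hc
    have h1 := hno a (c.mapLe hHG) ((SimpleGraph.Walk.isCycle_mapLe hHG).2 hc)
    have h2 : c.edges.toFinset ⊆ (p.edges ++ q.edges).toFinset := by
      intro e he
      have := c.edges_subset_edgeSet (List.mem_toFinset.1 he)
      rw [SimpleGraph.edgeSet_fromEdgeSet] at this
      simpa using this.1
    have h3 := card_le_card h2
    rw [List.toFinset_card_of_nodup hc.edges_nodup] at h3
    have h4 := List.toFinset_card_le (p.edges ++ q.edges)
    simp only [List.length_append, SimpleGraph.Walk.length_edges] at h3 h4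
    simp only [SimpleGraph.Walk.mapLe, SimpleGraph.Walk.length_map] at h1
    omega
  have e1 : (p.transfer H hpH).IsPath := by
    rw [hac.isPath_iff_isChain]; simpa using hp
  have e2 : (q.transfer H hqH).IsPath := by
    rw [hac.isPath_iff_isChain]; simpa using hq
  have := congrArg Subtype.val (hac.path_unique ⟨_, e1⟩ ⟨_, e2⟩)
  have h5 := congrArg SimpleGraph.Walk.support this
  simp only [SimpleGraph.Walk.support_transfer] at h5
  exact SimpleGraph.Walk.ext_support h5

section
variable {V : Type*} [Fintype V] [DecidableEq V] (G : SimpleGraph V) [DecidableRel G.Adj]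

theorem reach_walk (j : ℕ) : ∀ (u v x : V) (h : G.Adj u v), x ∈ reach G j u v →
    ∃ p : G.Walk v x, p.length = j ∧ (SimpleGraph.Walk.cons h p).edges.IsChain (· ≠ ·) := by
  induction j with
  | zero =>
    intro u v x h hx
    simp only [reach, mem_singleton] at hx
    subst hx
    exact ⟨SimpleGraph.Walk.nil, by simp, by simp⟩
  | succ j ih =>
    intro u v x h hx
    simp only [reach, mem_biUnion, mem_erase, SimpleGraph.mem_neighborFinset] at hx
    obtain ⟨w, ⟨hwu, hvw⟩, hx⟩ := hx
    obtain ⟨p, hp, hc⟩ := ih v w x hvw hx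
    refine ⟨SimpleGraph.Walk.cons hvw p, by simp [hp], ?_⟩
    simp only [SimpleGraph.Walk.edges_cons] at hc ⊢
    refine List.IsChain.cons_cons ?_ hc
    intro he
    rw [Sym2.eq_iff] at he
    rcases he with ⟨h1, h2⟩ | ⟨h1, h2⟩
    · exact h.ne h1
    · exact hwu h1.symm

theorem reach_disjoint (k : ℕ)
    (hno : ∀ (v : V) (w : G.Walk v v), w.IsCycle → 2 * k < w.length)
    (j : ℕ) (hj : j + 1 ≤ k) (v w w' : V) (hw : G.Adj v w) (hw' : G.Adj v w') (hne : w ≠ w') :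
    Disjoint (reach G j v w) (reach G j v w') := by
  rw [disjoint_left]
  intro x hx hx'
  obtain ⟨p, hp, hc⟩ := reach_walk G j v w x hw hx
  obtain ⟨q, hq, hc'⟩ := reach_walk G j v w' x hw' hx'
  have := unique_walk G k hno _ _ hc hc' (by simp [hp]; omega) (by simp [hq]; omega)
  simp only [SimpleGraph.Walk.cons.injEq] at this
  exact hne this.1

theorem reach_card_succ (k : ℕ)
    (hno : ∀ (v : V) (w : G.Walk v v), w.IsCycle → 2 * k < w.length)
    (j : ℕ) (hj : j + 1 ≤ k) (u v : V) :
    (reach G (j + 1) u v).card = ∑ w ∈ (G.neighborFinset v).erase u, (reach G j v w).card := by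
  rw [reach, card_biUnion]
  intro a ha b hb hab
  rw [mem_coe, mem_erase, SimpleGraph.mem_neighborFinset] at ha hb
  exact reach_disjoint G k hno j hj v a b ha.2 hb.2 hab

theorem reach_sum_le (k : ℕ)
    (hno : ∀ (v : V) (w : G.Walk v v), w.IsCycle → 2 * k < w.length)
    (j : ℕ) (hj : j + 1 ≤ k) (v : V) :
    ∑ w ∈ G.neighborFinset v, (reach G j v w).card ≤ Fintype.card V := by
  rw [← card_biUnion]
  · exact card_le_univ _
  intro a ha b hb hab
  rw [mem_coe, SimpleGraph.mem_neighborFinset] at ha hb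
  exact reach_disjoint G k hno j hj v a b ha hb hab

theorem erase_nonempty (hmin : ∀ v, 2 ≤ G.degree v) (u v : V) :
    ((G.neighborFinset v).erase u).Nonempty := by
  rw [← card_pos]
  have := pred_card_le_card_erase (s := G.neighborFinset v) (a := u)
  have h2 := hmin v
  rw [← G.card_neighborFinset_eq_degree] at h2
  omega

theorem reach_nonempty (hmin : ∀ v, 2 ≤ G.degree v) (j : ℕ) :
    ∀ u v : V, (reach G j u v).Nonempty := by
  induction j with
  | zero => intro u v; simp [reach]
  | succ j ih =>
    intro u v
    obtain ⟨w, hw⟩ := erase_nonempty G hmin u v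
    obtain ⟨x, hx⟩ := ih v w
    exact ⟨x, by rw [reach, mem_biUnion]; exact ⟨w, hw, hx⟩⟩

end

theorem sum_log_le {ι : Type*} (A : Finset ι) (hA : A.Nonempty) (f : ι → ℝ)
    (hf : ∀ i ∈ A, 0 < f i) :
    ∑ i ∈ A, Real.log (f i) ≤ A.card * (Real.log (∑ i ∈ A, f i) - Real.log A.card) := by
  have hS : 0 < ∑ i ∈ A, f i := sum_pos hf hA
  have hc : (0 : ℝ) < A.card := by exact_mod_cast hA.card_pos
  set S := ∑ i ∈ A, f i with hSdef
  have key : ∀ i ∈ A, Real.log (f i) ≤ f i * (A.card / S) - 1 + (Real.log S - Real.log A.card) := by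
    intro i hi
    have h1 := Real.log_le_sub_one_of_pos (x := f i * (A.card / S))
      (mul_pos (hf i hi) (div_pos hc hS))
    rw [Real.log_mul (hf i hi).ne' (div_pos hc hS).ne', Real.log_div hc.ne' hS.ne'] at h1
    linarith
  refine (sum_le_sum key).trans (le_of_eq ?_)
  rw [sum_add_distrib, sum_sub_distrib, ← sum_mul, ← hSdef]
  simp only [sum_const, nsmul_eq_mul]
  field_simp
  ring

theorem convex_aux : ConvexOn ℝ (Set.Ici (2 : ℝ)) fun x => x * Real.log (x - 1) := by
  have hd : ∀ x : ℝ, 1 < x → HasDerivAt (fun x : ℝ => x * Real.log (x - 1))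
      (Real.log (x - 1) + x * (1 / (x - 1))) x := by
    intro x hx
    have h := (hasDerivAt_id x).mul (((hasDerivAt_id x).sub_const 1).log
      (by simp only [id]; linarith))
    simpa using! h
  refine MonotoneOn.convexOn_of_deriv (convex_Ici _) ?_ ?_ ?_
  · intro x hx
    have hx : (2 : ℝ) ≤ x := hx
    exact (hd x (by linarith)).continuousAt.continuousWithinAt
  · intro x hx
    rw [interior_Ici] at hx
    have hx : (2 : ℝ) < x := hx
    exact (hd x (by linarith)).differentiableAt.differentiableWithinAt
  · rw [interior_Ici]
    intro x hx y hy hxy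
    have hx : (2 : ℝ) < x := hx
    have hy : (2 : ℝ) < y := hy
    rw [(hd x (by linarith)).deriv, (hd y (by linarith)).deriv]
    have hx1 : 0 < x - 1 := by linarith
    have hy1 : 0 < y - 1 := by linarith
    have h1 := Real.log_le_sub_one_of_pos (x := (x - 1) / (y - 1)) (by positivity)
    rw [Real.log_div hx1.ne' hy1.ne'] at h1
    have h2 : x * (1 / (x - 1)) - y * (1 / (y - 1)) = (y - x) / ((x - 1) * (y - 1)) := by
      field_simp; ring
    have h3 : (x - 1) / (y - 1) - 1 = - ((y - x) / (y - 1)) := by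
      field_simp; ring
    have h4 : (y - x) / ((x - 1) * (y - 1)) ≤ (y - x) / (y - 1) := by
      apply div_le_div_of_nonneg_left (by linarith) hy1
      nlinarith
    linarith

section
variable {V : Type*} [Fintype V] [DecidableEq V] (G : SimpleGraph V) [DecidableRel G.Adj]

theorem swap_sum (g : V → V → ℝ) :
    ∑ u, ∑ v ∈ G.neighborFinset u, g u v = ∑ v, ∑ u ∈ G.neighborFinset v, g u v := by
  apply sum_comm'
  intro x y
  simp [G.adj_comm]

/-- The logarithm sum grows by a fixed amount with each step. -/
theorem log_sum_step (hmin : ∀ v, 2 ≤ G.degree v) (k : ℕ)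
    (hno : ∀ (v : V) (w : G.Walk v v), w.IsCycle → 2 * k < w.length)
    (j : ℕ) (hj : j + 1 ≤ k) :
    (∑ v, (G.degree v : ℝ) * Real.log (G.degree v - 1)) +
      ∑ u, ∑ v ∈ G.neighborFinset u, Real.log ((reach G j u v).card : ℝ) ≤
      ∑ u, ∑ v ∈ G.neighborFinset u, Real.log ((reach G (j + 1) u v).card : ℝ) := by
  rw [swap_sum G (fun u v => Real.log ((reach G (j + 1) u v).card : ℝ)), ← sum_add_distrib]
  apply sum_le_sum
  intro v _
  set F : V → ℝ := fun w => Real.log ((reach G j v w).card : ℝ) with hF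
  have hdeg : (2 : ℝ) ≤ G.degree v := by exact_mod_cast hmin v
  have hd1 : (0 : ℝ) < G.degree v - 1 := by linarith
  have key : ∀ u ∈ G.neighborFinset v,
      Real.log (G.degree v - 1) + ((∑ w ∈ G.neighborFinset v, F w) - F u) / (G.degree v - 1) ≤
        Real.log ((reach G (j + 1) u v).card : ℝ) := by
    intro u hu
    have h1 := sum_log_le ((G.neighborFinset v).erase u) (erase_nonempty G hmin u v)
      (fun w => ((reach G j v w).card : ℝ))
      (fun w _ => by exact_mod_cast (reach_nonempty G hmin j v w).card_pos)
    rw [card_erase_of_mem hu, G.card_neighborFinset_eq_degree,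
      Nat.cast_sub (by have := hmin v; omega), Nat.cast_one, sum_erase_eq_sub hu,
      ← Nat.cast_sum, ← reach_card_succ G k hno j hj u v] at h1
    have h2 : ((∑ w ∈ G.neighborFinset v, F w) - F u) / (G.degree v - 1) ≤
        Real.log ((reach G (j + 1) u v).card : ℝ) - Real.log (G.degree v - 1) := by
      rw [div_le_iff₀ hd1, mul_comm]
      exact h1
    linarith
  refine le_trans (le_of_eq ?_) (sum_le_sum key)
  rw [sum_add_distrib, ← sum_div, sum_sub_distrib]
  simp only [sum_const, nsmul_eq_mul, G.card_neighborFinset_eq_degree]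
  field_simp

theorem log_sum (hmin : ∀ v, 2 ≤ G.degree v) (k : ℕ)
    (hno : ∀ (v : V) (w : G.Walk v v), w.IsCycle → 2 * k < w.length)
    (j : ℕ) (hj : j ≤ k) :
    (j : ℝ) * (∑ v, (G.degree v : ℝ) * Real.log (G.degree v - 1)) ≤
      ∑ u, ∑ v ∈ G.neighborFinset u, Real.log ((reach G j u v).card : ℝ) := by
  induction j with
  | zero => simp [reach]
  | succ j ih =>
    have h1 := ih (by omega)
    have h2 := log_sum_step G hmin k hno j hj
    push_cast
    linarith

/-- The bound for graphs of minimum degree at least two. -/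
theorem min_degree_case [Nonempty V] (hmin : ∀ v, 2 ≤ G.degree v) (k : ℕ) (hk : 0 < k)
    (hno : ∀ (v : V) (w : G.Walk v v), w.IsCycle → 2 * k < w.length)
    (d : ℝ) (hd2 : 2 ≤ d) (hd : d * Fintype.card V ≤ ∑ v, (G.degree v : ℝ)) :
    (d - 1) ^ k ≤ Fintype.card V := by
  obtain ⟨m, rfl⟩ : ∃ m, k = m + 1 := ⟨k - 1, by omega⟩
  set n : ℝ := (Fintype.card V : ℝ) with hn
  have hn0 : 0 < n := by rw [hn]; exact_mod_cast Fintype.card_pos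
  set D : ℝ := ∑ v, (G.degree v : ℝ) with hD
  set c : ℝ := D / n with hc
  have hdc : d ≤ c := by rw [hc, le_div_iff₀ hn0]; exact hd
  have hDc : D = n * c := by rw [hc]; field_simp
  have hc1 : 0 < c - 1 := by linarith
  have hc0 : 0 < c := by linarith
  -- convexity
  have hconv : D * Real.log (c - 1) ≤ ∑ v, (G.degree v : ℝ) * Real.log (G.degree v - 1) := by
    have h := convex_aux.map_sum_le (t := (univ : Finset V)) (w := fun _ => 1 / n)
      (p := fun v => (G.degree v : ℝ)) (fun _ _ => by positivity)
      (by simp only [sum_const, card_univ, nsmul_eq_mul, ← hn]; field_simp)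
      (fun v _ => by
        have : (2 : ℝ) ≤ G.degree v := by exact_mod_cast hmin v
        exact this)
    simp only [smul_eq_mul, ← mul_sum, ← hD] at h
    have e : 1 / n * D = c := by rw [hc]; ring
    rw [e, one_div, inv_mul_eq_div, le_div_iff₀ hn0] at h
    rw [hDc]; linarith
  have hlow := log_sum G hmin (m + 1) hno m (by omega)
  -- upper bound
  let A : Finset (Σ _ : V, V) := univ.sigma fun u => G.neighborFinset u
  have hAc : (A.card : ℝ) = D := by simp [A, hD]
  have hD0 : 0 < D := by rw [hDc]; positivity
  have hA : A.Nonempty := by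
    rw [← card_pos]
    have : (0 : ℝ) < A.card := by rw [hAc]; exact hD0
    exact_mod_cast this
  have hup := sum_log_le A hA (fun x => ((reach G m x.1 x.2).card : ℝ))
    (fun x _ => by exact_mod_cast (reach_nonempty G hmin m x.1 x.2).card_pos)
  have hpos := sum_pos (s := A) (f := fun x => ((reach G m x.1 x.2).card : ℝ))
    (fun x _ => by exact_mod_cast (reach_nonempty G hmin m x.1 x.2).card_pos) hA
  rw [hAc] at hup
  simp only [A, sum_sigma] at hup hpos
  have htot : ∑ u, ∑ v ∈ G.neighborFinset u, ((reach G m u v).card : ℝ) ≤ n * n := by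
    calc _ ≤ ∑ u : V, n := by
          apply sum_le_sum
          intro u _
          have := reach_sum_le G (m + 1) hno m le_rfl u
          rw [hn]
          exact_mod_cast this
      _ = n * n := by simp [hn]
  have hlog := Real.log_le_log hpos htot
  have h1 : D * ((m : ℝ) * Real.log (c - 1)) ≤ D * (Real.log (n * n) - Real.log D) := by
    have a1 : (m : ℝ) * (D * Real.log (c - 1)) ≤
        m * ∑ v, (G.degree v : ℝ) * Real.log (G.degree v - 1) :=
      mul_le_mul_of_nonneg_left hconv (by positivity)
    have a2 := mul_le_mul_of_nonneg_left (sub_le_sub_right hlog (Real.log D)) hD0.le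
    linarith
  have h2 := le_of_mul_le_mul_left h1 hD0
  rw [← Real.log_pow, ← Real.log_div (by positivity) hD0.ne',
    Real.log_le_log_iff (by positivity) (by positivity), hDc,
    mul_div_mul_left _ _ hn0.ne', le_div_iff₀ hc0] at h2
  calc (d - 1) ^ (m + 1) ≤ (c - 1) ^ (m + 1) :=
        pow_le_pow_left₀ (by linarith) (by linarith) _
    _ = (c - 1) ^ m * (c - 1) := pow_succ _ _
    _ ≤ (c - 1) ^ m * c := mul_le_mul_of_nonneg_left (by linarith) (by positivity)
    _ ≤ n := h2

end

universe u

theorem general_case (k : ℕ) (hk : 0 < k) (d : ℝ) (hd2 : 2 ≤ d) (N : ℕ) :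
    ∀ {V : Type u} [Fintype V] [DecidableEq V] [Nonempty V] (G : SimpleGraph V)
    [DecidableRel G.Adj],
    Fintype.card V = N →
    (∀ (v : V) (w : G.Walk v v), w.IsCycle → 2 * k < w.length) →
    d * Fintype.card V ≤ 2 * (G.edgeFinset.card : ℝ) →
    (d - 1) ^ k ≤ Fintype.card V := by
  induction N with
  | zero =>
    intro V _ _ _ G _ hN
    exact absurd hN Fintype.card_ne_zero
  | succ N ih =>
    intro V _ _ _ G _ hN hno hd
    by_cases hmin : ∀ v, 2 ≤ G.degree v
    · refine min_degree_case G hmin k hk hno d hd2 ?_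
      rw [← Nat.cast_sum, G.sum_degrees_eq_twice_card_edges]
      push_cast
      exact hd
    push Not at hmin
    obtain ⟨x, hx⟩ := hmin
    have hcard : Fintype.card ({x}ᶜ : Set V) = N := by
      rw [Fintype.card_compl_set, hN]; simp
    have he := G.card_edgeFinset_induce_compl_singleton x
    rw [G.card_edgeFinset_deleteIncidenceSet x] at he
    have he' : (G.edgeFinset.card : ℝ) ≤ ((G.induce ({x}ᶜ : Set V)).edgeFinset.card : ℝ) + 1 := by
      have : G.edgeFinset.card ≤ (G.induce ({x}ᶜ : Set V)).edgeFinset.card + 1 := by omega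
      exact_mod_cast this
    rw [hN] at hd
    push_cast at hd
    have hNpos : 0 < N := by
      by_contra h0
      have h0 : N = 0 := by omega
      subst h0
      have h1 := G.card_edgeFinset_le_card_choose_two
      rw [hN] at h1
      have h2 : G.edgeFinset.card = 0 := by simpa using h1
      rw [h2] at hd
      norm_num at hd
      linarith
    haveI : Nonempty ({x}ᶜ : Set V) := Fintype.card_pos_iff.1 (by omega)
    have := ih (G.induce ({x}ᶜ : Set V)) hcard (by
      intro v w hw
      let f := (SimpleGraph.Embedding.induce (G := G) ({x}ᶜ : Set V))
      have := hno _ (w.map f.toHom) (hw.map f.injective)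
      simpa using this) (by rw [hcard]; linarith)
    rw [hcard] at this
    rw [hN]
    push_cast
    linarith

end MooreAux


/-- Moore bound: Let `G` be a finite simple graph with average degree
`d = 2|E|/|V|`.  If `d ≥ 2` and `(d−1)^k > |V|` for a positive integer `k`, then `G`
contains a cycle of length at most `2k`. -/
theorem moore_bound_short_cycle {V : Type*} [Fintype V] [DecidableEq V]
    (G : SimpleGraph V) [DecidableRel G.Adj]
    (k : ℕ) (hk : 0 < k)
    (d : ℝ) (hd : d = 2 * (G.edgeFinset.card : ℝ) / (Fintype.card V : ℝ))
    (hd2 : 2 ≤ d) (hdk : (Fintype.card V : ℝ) < (d - 1) ^ k) :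
    ∃ (v : V) (w : G.Walk v v), w.IsCycle ∧ w.length ≤ 2 * k := by
  by_contra hcon
  push Not at hcon
  have hne : Nonempty V := by
    by_contra h
    rw [not_nonempty_iff] at h
    simp at hd
    linarith
  have hn : (0 : ℝ) < Fintype.card V := by exact_mod_cast Fintype.card_pos
  have := MooreAux.general_case k hk d hd2 _ G rfl hcon (by
    rw [hd]; apply le_of_eq; field_simp)
  linarith
end

section
/- Let m, n, s be positive integers with 1 ≤ n ≤ m, let x, y, z : [m] → [s] be probe maps, and suppose that for every S ⊆ [m] with |S| = n there exists an assignment σ_S : {1,2,3} × [s] → GF(2) such that for every u ∈ [m]: σ_S(1, x(u))·σ_S(2, y(u)) + σ_S(3, z(u)) = 1 if and only if u ∈ S. For each S ⊆ [m] with |S| = n define the polynomial P_S = ∏_{u∈S} (X_{(1,x(u))}·X_{(2,y(u))} + X_{(3,z(u))}) in the polynomial ring over GF(2) in the variables X_v, v ∈ {1,2,3} × [s]. Then the family {P_S : S ⊆ [m], |S| = n} is linearly independent over GF(2). -/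
open MvPolynomial

/-- Suppose the probe maps `x, y, z : [m] → [s]` come from a scheme
with query function `(x,y,z) ↦ (x∧y)⊕z` correctly representing every set of size
exactly `n` (over GF(2), the query evaluates to `σ(1,x(u))·σ(2,y(u)) + σ(3,z(u))`).
Then the polynomials `P_S = ∏_{u∈S} (X_{(1,x(u))}·X_{(2,y(u))} + X_{(3,z(u))})`,
for `S ⊆ [m]` with `|S| = n`, are linearly independent over GF(2). -/
theorem scheme_polynomials_linearly_independent
    (m n s : ℕ) (hm : 0 < m) (hn : 1 ≤ n) (hnm : n ≤ m) (hs : 0 < s)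
    (x y z : Fin m → Fin s)
    (hscheme : ∀ S : Finset (Fin m), S.card = n →
      ∃ σ : Fin 3 × Fin s → ZMod 2,
        ∀ u : Fin m,
          (σ (0, x u) * σ (1, y u) + σ (2, z u) = 1 ↔ u ∈ S)) :
    LinearIndependent (ZMod 2)
      (fun S : {S : Finset (Fin m) // S.card = n} =>
        (∏ u ∈ S.1,
          (X (0, x u) * X (1, y u) + X (2, z u)) :
          MvPolynomial (Fin 3 × Fin s) (ZMod 2))) := by
  rw [Fintype.linearIndependent_iff]
  intro g hg T
  obtain ⟨σ, hσ⟩ := hscheme T.1 T.2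
  have h := congrArg (MvPolynomial.eval σ) hg
  rw [map_sum, map_zero, Finset.sum_eq_single T] at h
  · rw [smul_eval, map_prod, Finset.prod_eq_one, mul_one] at h
    · exact h
    · intro u hu
      simpa using (hσ u).2 hu
  · intro S _ hST
    have hsub : ¬ S.1 ⊆ T.1 := by
      intro hsub
      apply hST
      apply Subtype.ext
      exact Finset.eq_of_subset_of_card_le hsub (by rw [S.2, T.2])
    obtain ⟨u, huS, huT⟩ := Finset.not_subset.1 hsub
    rw [smul_eval, map_prod, Finset.prod_eq_zero huS, mul_zero]
    have h1 : ¬ (σ (0, x u) * σ (1, y u) + σ (2, z u) = 1) := fun h => huT ((hσ u).1 h)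
    have key : ∀ a : ZMod 2, a ≠ 1 → a = 0 := by decide
    simpa using key _ h1
  · intro h
    exact absurd (Finset.mem_univ T) h
end
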